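/- arXiv:1709.05389 — 5 statements merged into one kernel-verified Lean document; each statement's English description precedes it below -/
import Mathlib

section
/- For every complex number s with Re(s) > −1 and s ≠ 1, every real number a with 0 < a ≤ 1, and every natural number m with m > Re(s) − 1, the Hurwitz zeta function satisfies ζ(s,a) = a^{1−s} · ( 1/(s−1) + 1/(2a) + ∫₀^∞ w_s(x)/(a² + x²) dx ). -/
open Real Complex MeasureTheory Set

/-- `g t = 1/(e^{2πt} - 1)`. -/
noncomputable def g (t : ℝ) : ℝ := 1 / (Real.exp (2 * π * t) - 1)

/-- The weight function
`w_s(x) = (2(−1)^m x^s)/(Γ(s)Γ(m+1−s)) · ∫_x^∞ (t−x)^{m−s} g^{(m)}(t) dt`. -/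
noncomputable def w (s : ℂ) (m : ℕ) (x : ℝ) : ℂ :=
  (2 * (-1) ^ m * (x : ℂ) ^ s) / (Complex.Gamma s * Complex.Gamma ((m : ℂ) + 1 - s)) *
    ∫ t in Ioi x, ((t - x : ℝ) : ℂ) ^ ((m : ℂ) - s) * ((iteratedDeriv m g t : ℝ) : ℂ)

/-- The frequencies `2π(n+1)`. -/
noncomputable def freq (n : ℕ) : ℝ := 2 * π * (n + 1)

lemma freq_pos (n : ℕ) : 0 < freq n := by unfold freq; positivity

lemma one_le_freq (n : ℕ) : 1 ≤ freq n := by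
  unfold freq
  nlinarith [pi_gt_three, (Nat.cast_nonneg n : (0 : ℝ) ≤ n)]

lemma summable_freq_pow_mul_exp (k : ℕ) {t : ℝ} (ht : 0 < t) :
    Summable fun n ↦ freq n ^ k * Real.exp (-freq n * t) := by
  have h := ((summable_nat_add_iff 1).mpr
    (Real.summable_pow_mul_exp_neg_nat_mul k (r := 2 * π * t) (by positivity))).mul_left
      ((2 * π) ^ k)
  refine h.congr fun n ↦ ?_
  unfold freq
  push_cast
  rw [mul_pow (2 * π), mul_assoc]
  ring_nf

lemma summable_inv_freq_sq : Summable fun n ↦ (freq n ^ 2)⁻¹ := by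
  have h := ((summable_nat_add_iff 1).mpr
    (Real.summable_nat_pow_inv.mpr one_lt_two)).mul_left (((2 * π) ^ 2)⁻¹)
  refine h.congr fun n ↦ ?_
  unfold freq
  push_cast
  rw [mul_pow (2 * π), mul_inv]

lemma hasSum_exp_freq {t : ℝ} (ht : 0 < t) :
    HasSum (fun n ↦ Real.exp (-freq n * t)) (g t) := by
  have h1 : Real.exp (-(2 * π * t)) < 1 := Real.exp_lt_one_iff.mpr (by simp; positivity)
  have h := (hasSum_geometric_of_lt_one (Real.exp_pos _).le h1).mul_left (Real.exp (-(2 * π * t)))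
  convert! h using 1
  · ext n
    rw [← Real.exp_nat_mul, ← Real.exp_add, freq]
    congr 1
    ring
  · have h2 : Real.exp (2 * π * t) - 1 ≠ 0 := by
      have : 1 < Real.exp (2 * π * t) := Real.one_lt_exp_iff.mpr (by positivity)
      linarith
    rw [g, Real.exp_neg]
    have h3 := Real.exp_pos (2 * π * t)
    field_simp

lemma iteratedDeriv_g (m : ℕ) {t : ℝ} (ht : 0 < t) :
    iteratedDeriv m g t = ∑' n, (-freq n) ^ m * Real.exp (-freq n * t) := by
  induction m generalizing t with
  | zero => simpa using (hasSum_exp_freq ht).tsum_eq.symm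
  | succ m ih =>
    rw [iteratedDeriv_succ]
    have hev : iteratedDeriv m g =ᶠ[nhds t]
        fun y ↦ ∑' n, (-freq n) ^ m * Real.exp (-freq n * y) := by
      filter_upwards [Ioi_mem_nhds ht] with y hy using ih hy
    rw [hev.deriv_eq]
    have hsum (k : ℕ) {y : ℝ} (hy : 0 < y) :
        Summable fun n ↦ (-freq n) ^ k * Real.exp (-freq n * y) := by
      refine (summable_freq_pow_mul_exp k hy).of_norm_bounded fun n ↦ ?_
      simp [abs_of_pos (freq_pos n)]
    refine (hasDerivAt_tsum_of_isPreconnected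
      (u := fun n ↦ freq n ^ (m + 1) * Real.exp (-freq n * (t / 2)))
      (g' := fun n y ↦ (-freq n) ^ (m + 1) * Real.exp (-freq n * y)) (t := Ioi (t / 2))
      (summable_freq_pow_mul_exp _ (half_pos ht)) isOpen_Ioi isPreconnected_Ioi
      (fun n y _ ↦ ?_) (fun n y hy ↦ ?_) (y₀ := t) (half_lt_self ht) (hsum m ht)
      (half_lt_self ht)).deriv
    · have h := (((hasDerivAt_id y).const_mul (-freq n)).exp).const_mul ((-freq n) ^ m)
      convert! h using 1
      simp only [id]
      ring
    · have hy : t / 2 < y := hy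
      have := freq_pos n
      rw [norm_mul, norm_pow, norm_neg, Real.norm_of_nonneg this.le,
        Real.norm_of_nonneg (Real.exp_pos _).le]
      gcongr ?_ * Real.exp ?_
      nlinarith

lemma w_eq_tsum {s : ℂ} {m : ℕ} (hm : s.re - 1 < m) {x : ℝ} (hx : 0 < x) :
    w s m x = (Gamma s)⁻¹ *
      ∑' n, 2 * (freq n : ℂ) ^ (s - 1) * (x : ℂ) ^ s * (Real.exp (-freq n * x) : ℂ) := by
  have hre : 0 < ((m : ℂ) + 1 - s).re := by
    simp only [sub_re, add_re, natCast_re, one_re]; linarith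
  have hF : ∀ t ∈ Ioi (0 : ℝ), HasSum
      (fun n ↦ (((-freq n) ^ m * Real.exp (-freq n * x) : ℝ) : ℂ) * Real.exp (-freq n * t))
      ((iteratedDeriv m g (x + t) : ℝ) : ℂ) := by
    intro t ht
    have hxt : 0 < x + t := add_pos hx ht
    rw [iteratedDeriv_g m hxt]
    have hs : Summable fun n ↦ (-freq n) ^ m * Real.exp (-freq n * (x + t)) := by
      refine (summable_freq_pow_mul_exp m hxt).of_norm_bounded fun n ↦ ?_
      simp [abs_of_pos (freq_pos n)]
    convert! Complex.hasSum_ofReal.mpr hs.hasSum using 2 with n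
    rw [mul_add, Real.exp_add]
    push_cast
    ring
  have hsum : Summable fun n ↦
      ‖(((-freq n) ^ m * Real.exp (-freq n * x) : ℝ) : ℂ)‖ / freq n ^ ((m : ℂ) + 1 - s).re := by
    refine (summable_freq_pow_mul_exp m hx).of_nonneg_of_le (fun n ↦ ?_) (fun n ↦ ?_)
    · have := freq_pos n
      positivity
    · rw [Complex.norm_real, norm_mul, norm_pow, norm_neg, Real.norm_of_nonneg (freq_pos n).le,
        Real.norm_of_nonneg (Real.exp_pos _).le]
      refine div_le_self ?_ (Real.one_le_rpow (one_le_freq n) hre.le)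
      have := freq_pos n
      positivity
  have h := (hasSum_mellin (fun n ↦ Or.inr (freq_pos n)) hre hF hsum).tsum_eq
  have hint : ∫ t in Ioi x, ((t - x : ℝ) : ℂ) ^ ((m : ℂ) - s) * ((iteratedDeriv m g t : ℝ) : ℂ)
      = mellin (fun t ↦ ((iteratedDeriv m g (x + t) : ℝ) : ℂ)) ((m : ℂ) + 1 - s) := by
    have := (measurePreserving_add_left volume x).setIntegral_preimage_emb
      (measurableEmbedding_addLeft x)
      (fun t ↦ ((t - x : ℝ) : ℂ) ^ ((m : ℂ) - s) * ((iteratedDeriv m g t : ℝ) : ℂ)) (Ioi x)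
    rw [← this, mellin]
    simp only [preimage_const_add_Ioi, sub_self, add_sub_cancel_left, smul_eq_mul]
    congr! 4
    ring
  have hG : Gamma ((m : ℂ) + 1 - s) ≠ 0 := Gamma_ne_zero_of_re_pos hre
  rw [w, hint, ← h, ← tsum_mul_left, ← tsum_mul_left]
  congr 1
  ext n
  have hf : (freq n : ℂ) ≠ 0 := ofReal_ne_zero.mpr (freq_pos n).ne'
  have hp : (freq n : ℂ) ^ ((m : ℂ) + 1 - s) = (freq n : ℂ) ^ m * ((freq n : ℂ) ^ (s - 1))⁻¹ := by
    rw [← cpow_neg, ← cpow_natCast, ← cpow_add _ _ hf]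
    congr 1
    ring
  have hf1 : (freq n : ℂ) ^ (s - 1) ≠ 0 := by simp [cpow_eq_zero_iff, hf]
  rw [hp]
  push_cast
  rw [neg_pow (freq n : ℂ) m]
  have h1 : ((-1 : ℂ) ^ m) * (-1) ^ m = 1 := by rw [← mul_pow]; simp
  by_cases hs0 : Gamma s = 0
  · simp [hs0]
  field_simp
  linear_combination (x : ℂ) ^ s * h1

lemma one_div_exp_sub_one {t : ℝ} (ht : 0 < t) :
    1 / (Real.exp t - 1) = 1 / t - 1 / 2 + ∑' n, 2 * t / (t ^ 2 + freq n ^ 2) := by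
  have ht' : (t : ℂ) ≠ 0 := ofReal_ne_zero.mpr ht.ne'
  have hpi : (π : ℂ) ≠ 0 := ofReal_ne_zero.mpr pi_ne_zero
  have hx : (I * t / (2 * π) : ℂ) ∈ integerComplement := by
    rintro ⟨n, hn⟩
    have := congrArg Complex.im hn
    rw [show (I * t / (2 * π) : ℂ) = ((t / (2 * π) : ℝ) : ℂ) * I by push_cast; ring] at this
    rw [mul_I_im, ofReal_re, intCast_im] at this
    exact (by positivity : t / (2 * π) ≠ 0) this.symm
  have h := cot_series_rep' hx
  have hterm (n : ℕ) :
      (1 / ((I * t / (2 * π) : ℂ) - (n + 1)) + 1 / ((I * t / (2 * π) : ℂ) + (n + 1)))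
      = (-2 * π * I) * ((2 * t / (t ^ 2 + freq n ^ 2) : ℝ) : ℂ) := by
    have hd : (t ^ 2 + freq n ^ 2 : ℂ) ≠ 0 := by
      have : (t ^ 2 + freq n ^ 2 : ℝ) ≠ 0 := by positivity
      exact_mod_cast this
    have h1 : (I * t / (2 * π) : ℂ) - (n + 1) ≠ 0 := by
      have := integerComplement_add_ne_zero hx (-(n + 1 : ℤ))
      push_cast at this
      rwa [← sub_eq_add_neg] at this
    have h2 : (I * t / (2 * π) : ℂ) + (n + 1) ≠ 0 := by
      have := integerComplement_add_ne_zero hx (n + 1 : ℤ)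
      push_cast at this
      exact this
    rw [div_add_div _ _ h1 h2]
    push_cast
    rw [mul_div_assoc', div_eq_div_iff (mul_ne_zero h1 h2) hd]
    simp only [freq]
    push_cast
    field_simp
    linear_combination (2 * t ^ 3 * I) * I_sq
  rw [tsum_congr hterm, tsum_mul_left, ← ofReal_tsum, Complex.cot_pi_eq_exp_ratio,
    show (2 * π * I * (I * t / (2 * π)) : ℂ) = ((-t : ℝ) : ℂ) by
      field_simp; rw [I_sq]; push_cast; ring] at h
  have he1 : Real.exp (-t) < 1 := Real.exp_lt_one_iff.mpr (by linarith)
  have he2 : (1 - Real.exp (-t)) ≠ 0 := by linarith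
  have he3 : Real.exp t - 1 ≠ 0 := by
    have := Real.one_lt_exp_iff.mpr ht
    linarith
  have key : (((1 + Real.exp (-t)) / (2 * (1 - Real.exp (-t))) - 1 / t : ℝ) : ℂ) =
      ((∑' n, 2 * t / (t ^ 2 + freq n ^ 2) : ℝ) : ℂ) := by
    have he2' : (1 - cexp (-t : ℂ)) ≠ 0 := by exact_mod_cast he2
    refine mul_left_cancel₀ (a := (-2 * π * I : ℂ)) (by simp [hpi]) ?_
    rw [← h]
    push_cast
    field_simp
    rw [I_sq]
    ring
  rw [← ofReal_inj.mp key]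
  have he4 := Real.exp_pos t
  rw [Real.exp_neg] at he2 ⊢
  field_simp at he2 ⊢
  ring

/-- The remainder `1/(e^t - 1) - 1/t + 1/2`, as its partial fraction series. -/
noncomputable def remainder (t : ℝ) : ℝ := ∑' n, 2 * t / (t ^ 2 + freq n ^ 2)

lemma remainder_nonneg {t : ℝ} (ht : 0 < t) : 0 ≤ remainder t :=
  tsum_nonneg fun n ↦ by positivity

lemma remainder_eq {t : ℝ} (ht : 0 < t) :
    remainder t = 1 / (Real.exp t - 1) - 1 / t + 1 / 2 := by
  rw [one_div_exp_sub_one ht, remainder]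
  ring

lemma remainder_le_half {t : ℝ} (ht : 0 < t) : remainder t ≤ 1 / 2 := by
  have : t ≤ Real.exp t - 1 := by linarith [Real.add_one_le_exp t]
  have := one_div_le_one_div_of_le ht this
  rw [remainder_eq ht]
  linarith

lemma summable_remainder {t : ℝ} (ht : 0 < t) :
    Summable fun n ↦ 2 * t / (t ^ 2 + freq n ^ 2) := by
  refine (summable_inv_freq_sq.mul_left (2 * t)).of_nonneg_of_le
    (fun n ↦ by positivity) (fun n ↦ ?_)
  have := freq_pos n
  rw [div_eq_mul_inv]
  gcongr
  nlinarith

lemma remainder_le_mul {t : ℝ} (ht : 0 < t) :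
    remainder t ≤ (∑' n, 2 * (freq n ^ 2)⁻¹) * t := by
  rw [← tsum_mul_right]
  refine (summable_remainder ht).tsum_le_tsum (fun n ↦ ?_)
    ((summable_inv_freq_sq.mul_left 2).mul_right t)
  have := freq_pos n
  rw [div_eq_mul_inv, mul_right_comm]
  gcongr
  nlinarith

lemma continuousOn_remainder : ContinuousOn remainder (Ioi 0) := by
  have h : ContinuousOn (fun t : ℝ ↦ 1 / (Real.exp t - 1) - 1 / t + 1 / 2) (Ioi 0) := by
    refine ContinuousOn.add (ContinuousOn.sub ?_ ?_) continuousOn_const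
    · refine ContinuousOn.div continuousOn_const (by fun_prop) fun t ht ↦ ?_
      have := Real.one_lt_exp_iff.mpr ht
      linarith
    · exact ContinuousOn.div continuousOn_const continuousOn_id fun t ht ↦ (ne_of_gt ht)
  exact h.congr fun t ht ↦ remainder_eq ht

section Mellin

open Asymptotics Filter Topology

variable {a : ℝ}

lemma locallyIntegrableOn_exp_mul_remainder (a : ℝ) :
    LocallyIntegrableOn (fun t : ℝ ↦ ((Real.exp (-a * t) * remainder t : ℝ) : ℂ)) (Ioi 0) := by
  refine ContinuousOn.locallyIntegrableOn ?_ measurableSet_Ioi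
  exact continuous_ofReal.comp_continuousOn
    ((by fun_prop : ContinuousOn (fun t : ℝ ↦ Real.exp (-a * t)) (Ioi 0)).mul
      continuousOn_remainder)

lemma exp_mul_remainder_isBigO_atTop (a : ℝ) :
    (fun t : ℝ ↦ ((Real.exp (-a * t) * remainder t : ℝ) : ℂ)) =O[atTop]
      fun t ↦ Real.exp (-a * t) := by
  refine IsBigO.of_bound 1 ?_
  filter_upwards [eventually_gt_atTop 0] with t ht
  rw [Complex.norm_real, norm_mul, Real.norm_of_nonneg (remainder_nonneg ht), mul_comm]
  gcongr
  linarith [remainder_le_half ht]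

lemma exp_mul_remainder_isBigO_zero (ha : 0 < a) :
    (fun t : ℝ ↦ ((Real.exp (-a * t) * remainder t : ℝ) : ℂ)) =O[𝓝[>] 0]
      fun t : ℝ ↦ t ^ (-(-1 : ℝ)) := by
  refine IsBigO.of_bound (∑' n, 2 * (freq n ^ 2)⁻¹) ?_
  filter_upwards [self_mem_nhdsWithin] with t ht
  have ht : 0 < t := ht
  rw [Complex.norm_real, norm_mul, Real.norm_of_nonneg (remainder_nonneg ht),
    Real.norm_of_nonneg (Real.exp_pos _).le, neg_neg, Real.rpow_one, Real.norm_of_nonneg ht.le]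
  have h1 : Real.exp (-a * t) ≤ 1 := Real.exp_le_one_iff.mpr (by nlinarith)
  exact (mul_le_of_le_one_left (remainder_nonneg ht) h1).trans (remainder_le_mul ht)

lemma differentiableAt_mellin_exp_mul_remainder (ha : 0 < a) {s : ℂ} (hs : -1 < s.re) :
    DifferentiableAt ℂ (mellin fun t : ℝ ↦ ((Real.exp (-a * t) * remainder t : ℝ) : ℂ)) s :=
  mellin_differentiableAt_of_isBigO_rpow_exp ha (locallyIntegrableOn_exp_mul_remainder a)
    (exp_mul_remainder_isBigO_atTop a) (exp_mul_remainder_isBigO_zero ha) hs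

lemma mellinConvergent_exp_neg_mul (ha : 0 < a) {s : ℂ} (hs : 0 < s.re) :
    MellinConvergent (fun t : ℝ ↦ ((Real.exp (-a * t) : ℝ) : ℂ)) s := by
  refine mellinConvergent_of_isBigO_rpow_exp ha
    (ContinuousOn.locallyIntegrableOn (by fun_prop) measurableSet_Ioi)
    (IsBigO.of_norm_le fun t ↦ by
      rw [Complex.norm_real, Real.norm_of_nonneg (Real.exp_pos _).le]) (b := 0) ?_ hs
  refine IsBigO.of_bound 1 ?_
  filter_upwards [self_mem_nhdsWithin] with t ht
  have ht : 0 < t := ht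
  rw [Complex.norm_real, Real.norm_of_nonneg (Real.exp_pos _).le]
  simp only [neg_zero, Real.rpow_zero, norm_one, mul_one]
  exact Real.exp_le_one_iff.mpr (by nlinarith)

lemma mellin_exp_neg_mul (ha : 0 < a) {s : ℂ} (hs : 0 < s.re) :
    mellin (fun t : ℝ ↦ ((Real.exp (-a * t) : ℝ) : ℂ)) s = (a : ℂ) ^ (-s) * Gamma s := by
  rw [cpow_neg, ← inv_cpow _ _ (by rw [arg_ofReal_of_nonneg ha.le]; exact pi_pos.ne), ← one_div,
    ← integral_cpow_mul_exp_neg_mul_Ioi hs ha, mellin]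
  simp

lemma hurwitzZeta_eq_mellin_of_one_lt_re (ha : 0 < a) (ha1 : a ≤ 1) {s : ℂ} (hs : 1 < s.re) :
    HurwitzZeta.hurwitzZeta (a : UnitAddCircle) s =
      (a : ℂ) ^ (1 - s) / (s - 1) + (a : ℂ) ^ (-s) / 2 +
        (Gamma s)⁻¹ * mellin (fun t : ℝ ↦ ((Real.exp (-a * t) * remainder t : ℝ) : ℂ)) s := by
  have hs0 : 0 < s.re := by linarith
  have hs1 : 0 < (s - 1).re := by simpa using hs
  have hne : s - 1 ≠ 0 := fun h ↦ by simp [h] at hs1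
  have hG : Gamma s ≠ 0 := Gamma_ne_zero_of_re_pos hs0
  let F : ℝ → ℂ := fun t ↦ (Real.exp (-a * t) * (1 - Real.exp (-t))⁻¹ : ℝ)
  have hF : ∀ t ∈ Ioi (0 : ℝ), HasSum
      (fun n : ℕ ↦ (1 : ℂ) * Real.exp (-((n : ℝ) + a) * t)) (F t) := by
    intro t ht
    have h1 : Real.exp (-t) < 1 := Real.exp_lt_one_iff.mpr (neg_lt_zero.mpr ht)
    have h := (hasSum_geometric_of_lt_one (Real.exp_pos _).le h1).mul_left (Real.exp (-a * t))
    convert! Complex.hasSum_ofReal.mpr h using 2 with n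
    rw [← Real.exp_nat_mul, ← Real.exp_add, one_mul]
    congr 2
    ring
  have hz := HurwitzZeta.hasSum_hurwitzZeta_of_one_lt_re (a := a) ⟨ha.le, ha1⟩ hs
  have hsum : Summable fun n : ℕ ↦ ‖(1 : ℂ)‖ / ((n : ℝ) + a) ^ s.re := by
    refine hz.summable.norm.congr fun n ↦ ?_
    have hpos : 0 < (n : ℝ) + a := by positivity
    rw [norm_div, ← norm_cpow_eq_rpow_re_of_pos hpos]
    push_cast
    rfl
  have hm := hasSum_mellin (p := fun n : ℕ ↦ (n : ℝ) + a)
    (fun n ↦ Or.inr (by positivity)) hs0 hF hsum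
  have hmF : Gamma s * HurwitzZeta.hurwitzZeta (a : UnitAddCircle) s = mellin F s := by
    rw [← hm.tsum_eq, ← hz.tsum_eq, ← tsum_mul_left]
    congr! 2 with n
    push_cast
    ring
  have hdecomp : mellin F s = mellin (fun t : ℝ ↦
      ((t : ℂ) ^ (-1 : ℂ) • ((Real.exp (-a * t) : ℝ) : ℂ) +
        (1 / 2 : ℂ) • ((Real.exp (-a * t) : ℝ) : ℂ)) +
        ((Real.exp (-a * t) * remainder t : ℝ) : ℂ)) s := by
    refine setIntegral_congr_fun measurableSet_Ioi fun t ht ↦ ?_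
    have ht : 0 < t := ht
    simp only [F]
    have hne1 : Real.exp t - 1 ≠ 0 := by
      have := Real.one_lt_exp_iff.mpr ht
      linarith
    have hkey : Real.exp (-a * t) * (1 - Real.exp (-t))⁻¹ =
        t⁻¹ * Real.exp (-a * t) + 1 / 2 * Real.exp (-a * t) + Real.exp (-a * t) * remainder t := by
      have hinv : (1 - Real.exp (-t))⁻¹ = 1 + 1 / (Real.exp t - 1) := by
        have := Real.exp_pos t
        have hsub : 1 - Real.exp (-t) = (Real.exp t - 1) / Real.exp t := by
          rw [Real.exp_neg]
          field_simp
        rw [hsub, inv_div]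
        field_simp
        ring
      rw [remainder_eq ht, hinv]
      ring
    rw [hkey, cpow_neg_one]
    push_cast
    rfl
  have hc1 : MellinConvergent (fun t : ℝ ↦ (t : ℂ) ^ (-1 : ℂ) • ((Real.exp (-a * t) : ℝ) : ℂ)) s :=
    MellinConvergent.cpow_smul.mpr (mellinConvergent_exp_neg_mul ha (by simpa using hs))
  have hc2 : MellinConvergent (fun t : ℝ ↦ (1 / 2 : ℂ) • ((Real.exp (-a * t) : ℝ) : ℂ)) s :=
    (mellinConvergent_exp_neg_mul ha hs0).const_smul _
  have hc3 : MellinConvergent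
      (fun t : ℝ ↦ ((Real.exp (-a * t) * remainder t : ℝ) : ℂ)) s :=
    mellinConvergent_of_isBigO_rpow_exp ha (locallyIntegrableOn_exp_mul_remainder a)
      (exp_mul_remainder_isBigO_atTop a) (exp_mul_remainder_isBigO_zero ha) (by linarith)
  have hc12 := hasMellin_add hc1 hc2
  rw [hdecomp, (hasMellin_add hc12.1 hc3).2, hc12.2, mellin_cpow_smul, mellin_const_smul,
    mellin_exp_neg_mul ha hs0, ← sub_eq_add_neg, mellin_exp_neg_mul ha hs1, neg_sub] at hmF
  have hGs : Gamma s = (s - 1) * Gamma (s - 1) := by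
    rw [← Gamma_add_one _ hne, sub_add_cancel]
  have hG1 : Gamma (s - 1) ≠ 0 := Gamma_ne_zero_of_re_pos hs1
  refine mul_left_cancel₀ hG (hmF.trans ?_)
  rw [mul_add, mul_inv_cancel_left₀ hG, mul_add, smul_eq_mul]
  congr 2
  · rw [hGs]
    field_simp
  · ring

lemma isPreconnected_re_gt_diff_one : IsPreconnected ({s : ℂ | -1 < s.re} \ {1}) := by
  let ψ : ℂ → ℂ := fun z ↦ ((Real.exp z.re - 1 : ℝ) : ℂ) + z.im * I
  have hψ : Continuous ψ := by fun_prop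
  have hre (z : ℂ) : (ψ z).re = Real.exp z.re - 1 := by
    simp only [ψ, add_re, ofReal_re, re_ofReal_mul, I_re, mul_zero, add_zero]
  have him (z : ℂ) : (ψ z).im = z.im := by
    simp only [ψ, add_im, ofReal_im, im_ofReal_mul, I_im, mul_one, zero_add]
  have himage : ψ '' {((Real.log 2 : ℝ) : ℂ)}ᶜ = {s : ℂ | -1 < s.re} \ {1} := by
    ext s
    constructor
    · rintro ⟨z, hz, rfl⟩
      refine ⟨by rw [mem_ofPred_eq, hre]; linarith [Real.exp_pos z.re], fun h ↦ hz ?_⟩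
      have h : ψ z = 1 := h
      have h1 : Real.exp z.re - 1 = 1 := by rw [← hre, h, one_re]
      have h2 : z.im = 0 := by rw [← him, h, one_im]
      have h3 : z.re = Real.log 2 := by
        rw [← Real.log_exp z.re]
        congr 1
        linarith
      exact Complex.ext (by rw [h3, ofReal_re]) (by rw [h2, ofReal_im])
    · rintro ⟨hs, hs1⟩
      have hs : -1 < s.re := hs
      refine ⟨⟨Real.log (s.re + 1), s.im⟩, fun h ↦ hs1 ?_, ?_⟩
      · have h1 : Real.log (s.re + 1) = Real.log 2 := congrArg Complex.re h
        have h2 : s.im = 0 := congrArg Complex.im h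
        have h3 : s.re + 1 = 2 :=
          Real.log_injOn_pos (mem_Ioi.mpr (by linarith)) (mem_Ioi.mpr two_pos) h1
        exact Complex.ext (by rw [one_re]; linarith) (by rw [h2, one_im])
      · refine Complex.ext ?_ (him _)
        rw [hre, Real.exp_log (by linarith)]
        ring
  rw [← himage]
  exact (isConnected_compl_singleton_of_one_lt_rank (by simp) _).isPreconnected.image _
    hψ.continuousOn

lemma hurwitzZeta_eq_mellin (ha : 0 < a) (ha1 : a ≤ 1) {s : ℂ} (hs : -1 < s.re) (hs1 : s ≠ 1) :
    HurwitzZeta.hurwitzZeta (a : UnitAddCircle) s =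
      (a : ℂ) ^ (1 - s) / (s - 1) + (a : ℂ) ^ (-s) / 2 +
        (Gamma s)⁻¹ * mellin (fun t : ℝ ↦ ((Real.exp (-a * t) * remainder t : ℝ) : ℂ)) s := by
  have hopen : IsOpen ({s : ℂ | -1 < s.re} \ {1}) :=
    (isOpen_lt continuous_const Complex.continuous_re).sdiff isClosed_singleton
  have ha' : (a : ℂ) ≠ 0 := ofReal_ne_zero.mpr ha.ne'
  refine AnalyticOnNhd.eqOn_of_preconnected_of_eventuallyEq
    (f := HurwitzZeta.hurwitzZeta (a : UnitAddCircle))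
    (g := fun s ↦ (a : ℂ) ^ (1 - s) / (s - 1) + (a : ℂ) ^ (-s) / 2 +
        (Gamma s)⁻¹ * mellin (fun t : ℝ ↦ ((Real.exp (-a * t) * remainder t : ℝ) : ℂ)) s)
    (DifferentiableOn.analyticOnNhd (fun z hz ↦ ?_) hopen)
    (DifferentiableOn.analyticOnNhd (fun z hz ↦ ?_) hopen)
    isPreconnected_re_gt_diff_one (z₀ := 2) ⟨?_, ?_⟩ ?_ ⟨hs, hs1⟩
  · exact (HurwitzZeta.differentiableAt_hurwitzZeta _ hz.2).differentiableWithinAt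
  · have hz1 : z - 1 ≠ 0 := sub_ne_zero.mpr hz.2
    have h1 : DifferentiableAt ℂ (fun s : ℂ ↦ (a : ℂ) ^ (1 - s)) z :=
      DifferentiableAt.const_cpow (by fun_prop) (Or.inl ha')
    have h2 : DifferentiableAt ℂ (fun s : ℂ ↦ (a : ℂ) ^ (-s)) z :=
      DifferentiableAt.const_cpow (by fun_prop) (Or.inl ha')
    exact (((h1.div (by fun_prop) hz1).add (h2.div_const 2)).add
      ((differentiable_one_div_Gamma z).mul
        (differentiableAt_mellin_exp_mul_remainder ha hz.1))).differentiableWithinAt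
  · simp only [mem_ofPred_eq, re_ofNat]; norm_num
  · simp
  · have : {s : ℂ | 1 < s.re} ∈ 𝓝 (2 : ℂ) :=
      (isOpen_lt continuous_const Complex.continuous_re).mem_nhds (by simp)
    filter_upwards [this] with z hz using hurwitzZeta_eq_mellin_of_one_lt_re ha ha1 hz

end Mellin

section TermIntegrals

variable {s : ℂ} {a : ℝ}

/-- The `n`-th term of the Mellin integrand of `exp (-a t) * remainder t`. -/
noncomputable def mellinTerm (s : ℂ) (a : ℝ) (n : ℕ) (t : ℝ) : ℂ :=
  (t : ℂ) ^ s * ((Real.exp (-a * t) * (2 / (t ^ 2 + freq n ^ 2)) : ℝ) : ℂ)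

/-- The `n`-th term of the integrand `Γ(s) w_s(x) / (a² + x²)`. -/
noncomputable def weightTerm (s : ℂ) (a : ℝ) (n : ℕ) (x : ℝ) : ℂ :=
  2 * (freq n : ℂ) ^ (s - 1) * (x : ℂ) ^ s * (Real.exp (-freq n * x) : ℂ) /
    ((a ^ 2 + x ^ 2 : ℝ) : ℂ)

lemma integrableOn_rpow_mul_exp_neg_mul (ha : 0 < a) {σ : ℝ} (hσ : -1 < σ) :
    IntegrableOn (fun t : ℝ ↦ t ^ σ * Real.exp (-a * t)) (Ioi 0) := by
  simpa using integrableOn_rpow_mul_exp_neg_mul_rpow hσ one_pos ha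

lemma norm_mellinTerm_le (s : ℂ) (a : ℝ) (n : ℕ) {t : ℝ} (ht : 0 < t) :
    ‖mellinTerm s a n t‖ ≤ 2 * (freq n ^ 2)⁻¹ * (t ^ s.re * Real.exp (-a * t)) := by
  have := freq_pos n
  rw [mellinTerm, norm_mul, norm_cpow_eq_rpow_re_of_pos ht, Complex.norm_real,
    Real.norm_of_nonneg (by positivity), div_eq_mul_inv]
  calc t ^ s.re * (Real.exp (-a * t) * (2 * (t ^ 2 + freq n ^ 2)⁻¹))
      ≤ t ^ s.re * (Real.exp (-a * t) * (2 * (freq n ^ 2)⁻¹)) := by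
        gcongr
        nlinarith
    _ = _ := by ring

lemma integrableOn_mellinTerm (ha : 0 < a) (hs : -1 < s.re) (n : ℕ) :
    IntegrableOn (mellinTerm s a n) (Ioi 0) := by
  refine Integrable.mono'
    ((integrableOn_rpow_mul_exp_neg_mul ha hs).const_mul (2 * (freq n ^ 2)⁻¹)) ?_ ?_
  · refine ContinuousOn.aestronglyMeasurable (fun t ht ↦ ?_) measurableSet_Ioi
    have ht : 0 < t := ht
    refine ContinuousAt.continuousWithinAt (ContinuousAt.mul ?_ ?_)
    · exact continuousAt_ofReal_cpow_const _ _ (Or.inr ht.ne')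
    · refine continuous_ofReal.continuousAt.comp (ContinuousAt.mul (by fun_prop) ?_)
      have := freq_pos n
      exact ContinuousAt.div (by fun_prop) (by fun_prop) (by positivity)
  · filter_upwards [ae_restrict_mem measurableSet_Ioi] with t ht using norm_mellinTerm_le s a n ht

lemma summable_integral_norm_mellinTerm (ha : 0 < a) (hs : -1 < s.re) :
    Summable fun n ↦ ∫ t in Ioi 0, ‖mellinTerm s a n t‖ := by
  refine ((summable_inv_freq_sq.mul_left 2).mul_right
    (∫ t in Ioi 0, t ^ s.re * Real.exp (-a * t))).of_nonneg_of_le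
    (fun n ↦ integral_nonneg fun _ ↦ norm_nonneg _) (fun n ↦ ?_)
  rw [← integral_const_mul]
  exact setIntegral_mono_on (integrableOn_mellinTerm ha hs n).norm
    ((integrableOn_rpow_mul_exp_neg_mul ha hs).const_mul _) measurableSet_Ioi
    fun t ht ↦ norm_mellinTerm_le s a n ht

lemma mellin_exp_mul_remainder_eq_tsum (ha : 0 < a) (hs : -1 < s.re) :
    mellin (fun t : ℝ ↦ ((Real.exp (-a * t) * remainder t : ℝ) : ℂ)) s =
      ∑' n, ∫ t in Ioi 0, mellinTerm s a n t := by
  rw [(hasSum_integral_of_summable_integral_norm (fun n ↦ integrableOn_mellinTerm ha hs n)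
    (summable_integral_norm_mellinTerm ha hs)).tsum_eq]
  refine setIntegral_congr_fun measurableSet_Ioi fun t ht ↦ ?_
  have ht : 0 < t := ht
  have ht' : (t : ℂ) ≠ 0 := ofReal_ne_zero.mpr ht.ne'
  simp only [mellinTerm]
  rw [tsum_mul_left, ← ofReal_tsum, tsum_mul_left, remainder, smul_eq_mul]
  have h : ∑' n, 2 * t / (t ^ 2 + freq n ^ 2) = t * ∑' n, 2 / (t ^ 2 + freq n ^ 2) := by
    rw [← tsum_mul_left]
    congr 1
    ext n
    ring
  rw [h, cpow_sub _ _ ht', cpow_one]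
  push_cast
  field_simp

lemma weightTerm_eq (ha : 0 < a) (s : ℂ) (n : ℕ) {x : ℝ} (hx : 0 < x) :
    weightTerm s a n x =
      (a : ℂ) ^ (s - 1) * ((freq n / a : ℝ) • mellinTerm s a n (freq n / a * x)) := by
  have hf := freq_pos n
  have ha' : (a : ℂ) ≠ 0 := ofReal_ne_zero.mpr ha.ne'
  have hf' : (freq n : ℂ) ≠ 0 := ofReal_ne_zero.mpr hf.ne'
  have hcpow : ((freq n / a * x : ℝ) : ℂ) ^ s = (freq n : ℂ) ^ s / (a : ℂ) ^ s * (x : ℂ) ^ s := by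
    rw [ofReal_mul, mul_cpow_ofReal_nonneg (by positivity) hx.le, ofReal_div,
      div_cpow_ofReal_nonneg hf.le ha.le]
  have hd : ((a ^ 2 + x ^ 2 : ℝ) : ℂ) ≠ 0 := ofReal_ne_zero.mpr (by positivity)
  have hden : 2 / ((freq n / a * x) ^ 2 + freq n ^ 2) =
      2 * a ^ 2 / (freq n ^ 2 * (a ^ 2 + x ^ 2)) := by
    field_simp
    ring
  have hexp : -a * (freq n / a * x) = -freq n * x := by field_simp
  have has : (a : ℂ) ^ s ≠ 0 := by simp [cpow_eq_zero_iff, ha']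
  rw [weightTerm, mellinTerm, hcpow, hden, hexp, cpow_sub _ _ ha', cpow_sub _ _ hf', cpow_one,
    cpow_one, real_smul, ofReal_mul, ofReal_div (2 * a ^ 2), ofReal_mul (freq n ^ 2)]
  push_cast at hd ⊢
  field_simp

lemma integrableOn_weightTerm (ha : 0 < a) (hs : -1 < s.re) (n : ℕ) :
    IntegrableOn (weightTerm s a n) (Ioi 0) := by
  have hc : 0 < freq n / a := div_pos (freq_pos n) ha
  have h := (integrableOn_Ioi_comp_mul_left_iff (mellinTerm s a n) 0 hc).mpr
    (by simpa using integrableOn_mellinTerm ha hs n)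
  exact IntegrableOn.congr_fun ((h.smul (freq n / a)).const_mul ((a : ℂ) ^ (s - 1)))
    (fun x hx ↦ (weightTerm_eq ha s n hx).symm) measurableSet_Ioi

lemma integral_weightTerm (ha : 0 < a) (s : ℂ) (n : ℕ) :
    ∫ x in Ioi 0, weightTerm s a n x =
      (a : ℂ) ^ (s - 1) * ∫ t in Ioi 0, mellinTerm s a n t := by
  have hc : 0 < freq n / a := div_pos (freq_pos n) ha
  rw [setIntegral_congr_fun measurableSet_Ioi fun x hx ↦ weightTerm_eq ha s n hx,
    integral_const_mul, integral_smul, integral_comp_mul_left_Ioi' _ _ hc, mul_zero]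

lemma integral_norm_weightTerm (ha : 0 < a) (s : ℂ) (n : ℕ) :
    ∫ x in Ioi 0, ‖weightTerm s a n x‖ =
      ‖(a : ℂ) ^ (s - 1)‖ * ∫ t in Ioi 0, ‖mellinTerm s a n t‖ := by
  have hc : 0 < freq n / a := div_pos (freq_pos n) ha
  have h : EqOn (fun x ↦ ‖weightTerm s a n x‖)
      (fun x ↦ ‖(a : ℂ) ^ (s - 1)‖ * ((freq n / a) • ‖mellinTerm s a n (freq n / a * x)‖))
      (Ioi 0) := fun x hx ↦ by
    simp only
    rw [weightTerm_eq ha s n hx, norm_mul, norm_smul, Real.norm_of_nonneg hc.le, smul_eq_mul]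
  rw [setIntegral_congr_fun measurableSet_Ioi h, integral_const_mul, integral_smul,
    integral_comp_mul_left_Ioi' (fun t ↦ ‖mellinTerm s a n t‖) _ hc, mul_zero]

lemma integral_w_div (ha : 0 < a) (hs : -1 < s.re) {m : ℕ} (hm : s.re - 1 < m) :
    ∫ x in Ioi (0 : ℝ), w s m x / ((a ^ 2 + x ^ 2 : ℝ) : ℂ) = (a : ℂ) ^ (s - 1) *
      ((Gamma s)⁻¹ * mellin (fun t : ℝ ↦ ((Real.exp (-a * t) * remainder t : ℝ) : ℂ)) s) := by
  have hsum : Summable fun n ↦ ∫ x in Ioi 0, ‖weightTerm s a n x‖ := by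
    simp_rw [integral_norm_weightTerm ha s]
    exact (summable_integral_norm_mellinTerm ha hs).mul_left _
  have hw : EqOn (fun x ↦ w s m x / ((a ^ 2 + x ^ 2 : ℝ) : ℂ))
      (fun x ↦ (Gamma s)⁻¹ * ∑' n, weightTerm s a n x) (Ioi 0) := fun x hx ↦ by
    simp only [weightTerm]
    rw [w_eq_tsum hm hx, tsum_div_const, mul_div_assoc]
  rw [setIntegral_congr_fun measurableSet_Ioi hw, integral_const_mul,
    ← (hasSum_integral_of_summable_integral_norm (fun n ↦ integrableOn_weightTerm ha hs n)
      hsum).tsum_eq, mellin_exp_mul_remainder_eq_tsum ha hs]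
  simp_rw [integral_weightTerm ha s]
  rw [tsum_mul_left]
  ring

end TermIntegrals

theorem hurwitzZeta_eq_integral_weight (s : ℂ) (hs : -1 < s.re) (hs1 : s ≠ 1)
    (a : ℝ) (ha : 0 < a) (ha1 : a ≤ 1) (m : ℕ) (hm : s.re - 1 < m) :
    HurwitzZeta.hurwitzZeta (a : UnitAddCircle) s =
      (a : ℂ) ^ (1 - s) *
        (1 / (s - 1) + 1 / (2 * a) +
          ∫ x in Ioi (0 : ℝ), w s m x / ((a ^ 2 + x ^ 2 : ℝ) : ℂ)) := by
  have ha' : (a : ℂ) ≠ 0 := ofReal_ne_zero.mpr ha.ne'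
  have h1 : (a : ℂ) ^ (1 - s) * (a : ℂ) ^ (s - 1) = 1 := by
    rw [← cpow_add _ _ ha', sub_add_sub_cancel, sub_self, cpow_zero]
  have h2 : (a : ℂ) ^ (1 - s) = a * (a : ℂ) ^ (-s) := by
    rw [sub_eq_add_neg, cpow_add _ _ ha', cpow_one]
  have h3 : (a : ℂ) ^ (1 - s) * (1 / (2 * a)) = (a : ℂ) ^ (-s) / 2 := by
    rw [h2]
    field_simp
  rw [hurwitzZeta_eq_mellin ha ha1 hs hs1, integral_w_div ha hs hm, mul_add, mul_add, h3,
    ← mul_assoc _ ((a : ℂ) ^ (s - 1)), h1, one_mul, mul_one_div]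
end

section
/- ζ(2) = 3/2 + π ∫₀^∞ x² / ((1+x²) sinh²(πx)) dx, and also ζ(2) = 3/2 + 4 ∫₀^∞ x / ((e^{2πx} − 1)(1+x²)²) dx. -/
open Real MeasureTheory Set

open Filter Topology

theorem tendsto_inv_one_add_sq_atTop :
    Tendsto (fun x : ℝ => (1 + x ^ 2)⁻¹) atTop (𝓝 0) :=
  (tendsto_atTop_add_const_left _ 1 (tendsto_pow_atTop two_ne_zero)).inv_tendsto_atTop

theorem tendsto_div_one_add_sq_atTop :
    Tendsto (fun x : ℝ => x / (1 + x ^ 2)) atTop (𝓝 0) := by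
  refine squeeze_zero' ?_ ?_ tendsto_inv_atTop_zero
  · filter_upwards [eventually_gt_atTop 0] with x hx
    positivity
  · filter_upwards [eventually_gt_atTop 0] with x hx
    rw [inv_eq_one_div, div_le_div_iff₀ (by positivity) hx]
    nlinarith

theorem hasDerivAt_inv_one_add_sq (x : ℝ) :
    HasDerivAt (fun x : ℝ => (1 + x ^ 2)⁻¹) (-(2 * x) / (1 + x ^ 2) ^ 2) x := by
  have h := ((hasDerivAt_pow 2 x).const_add 1).fun_inv (by positivity)
  simpa using h

theorem hasDerivAt_div_one_add_sq (x : ℝ) :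
    HasDerivAt (fun x : ℝ => x / (1 + x ^ 2)) ((1 - x ^ 2) / (1 + x ^ 2) ^ 2) x := by
  refine ((hasDerivAt_id x).fun_div ((hasDerivAt_pow 2 x).const_add 1)
    (by positivity)).congr_deriv ?_
  simp only [id]
  ring

theorem integrableOn_and_integral_eq_of_hasDerivAt {F f : ℝ → ℝ} {l : ℝ} (h0 : F 0 = 0)
    (hF : ∀ x, HasDerivAt F (f x) x) (hf : ∀ x, 0 < x → 0 ≤ f x) (hl : Tendsto F atTop (𝓝 l)) :
    IntegrableOn f (Ioi 0) ∧ ∫ x in Ioi (0 : ℝ), f x = l :=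
  ⟨integrableOn_Ioi_deriv_of_nonneg' (fun x _ => hF x) hf hl, by
    rw [integral_Ioi_of_hasDerivAt_of_nonneg' (fun x _ => hF x) hf hl, h0, sub_zero]⟩

theorem integral_inv_one_add_sq_sq :
    IntegrableOn (fun x : ℝ => 1 / (1 + x ^ 2) ^ 2) (Ioi 0) ∧
      ∫ x in Ioi (0 : ℝ), 1 / (1 + x ^ 2) ^ 2 = π / 4 := by
  refine integrableOn_and_integral_eq_of_hasDerivAt
    (F := fun x => (arctan x + x / (1 + x ^ 2)) / 2) (by simp) (fun x => ?_)
    (fun x _ => by positivity) ?_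
  · refine (((hasDerivAt_arctan x).add
      (hasDerivAt_div_one_add_sq x)).div_const 2).congr_deriv ?_
    field
  · convert ((tendsto_arctan_atTop.mono_right nhdsWithin_le_nhds).add
      tendsto_div_one_add_sq_atTop).div_const 2 using 2
    ring

theorem integral_div_one_add_sq_sq :
    IntegrableOn (fun x : ℝ => x / (1 + x ^ 2) ^ 2) (Ioi 0) ∧
      ∫ x in Ioi (0 : ℝ), x / (1 + x ^ 2) ^ 2 = 1 / 2 := by
  refine integrableOn_and_integral_eq_of_hasDerivAt
    (F := fun x => (1 - (1 + x ^ 2)⁻¹) / 2) (by simp) (fun x => ?_)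
    (fun x _ => by positivity) ?_
  · refine (((hasDerivAt_inv_one_add_sq x).const_sub 1).div_const 2).congr_deriv ?_
    field
  · simpa using (tendsto_inv_one_add_sq_atTop.const_sub 1).div_const 2

theorem integral_sq_div_one_add_sq_cube :
    IntegrableOn (fun x : ℝ => x ^ 2 / (1 + x ^ 2) ^ 3) (Ioi 0) ∧
      ∫ x in Ioi (0 : ℝ), x ^ 2 / (1 + x ^ 2) ^ 3 = π / 16 := by
  refine integrableOn_and_integral_eq_of_hasDerivAt
    (F := fun x => (arctan x + x / (1 + x ^ 2) * (1 - 2 * (1 + x ^ 2)⁻¹)) / 8)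
    (by simp) (fun x => ?_) (fun x _ => by positivity) ?_
  · refine (((hasDerivAt_arctan x).add ((hasDerivAt_div_one_add_sq x).mul
      (((hasDerivAt_inv_one_add_sq x).const_mul 2).const_sub 1))).div_const 8).congr_deriv ?_
    field
  · convert ((tendsto_arctan_atTop.mono_right nhdsWithin_le_nhds).add
      (tendsto_div_one_add_sq_atTop.mul
        ((tendsto_inv_one_add_sq_atTop.const_mul 2).const_sub 1))).div_const 8 using 2
    ring

theorem integral_sq_div_one_add_sq_sq_mul {a : ℝ} (ha : 0 < a) :
    IntegrableOn (fun x : ℝ => x ^ 2 / ((1 + x ^ 2) ^ 2 * (x ^ 2 + a ^ 2))) (Ioi 0) ∧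
      ∫ x in Ioi (0 : ℝ), x ^ 2 / ((1 + x ^ 2) ^ 2 * (x ^ 2 + a ^ 2)) =
        π / (4 * (1 + a) ^ 2) := by
  obtain rfl | h1 := eq_or_ne a 1
  · convert integral_sq_div_one_add_sq_cube using 4 <;> ring
  have h2 : a ^ 2 - 1 ≠ 0 := by
    rw [show a ^ 2 - 1 = (a - 1) * (a + 1) by ring]
    exact mul_ne_zero (sub_ne_zero.2 h1) (by positivity)
  have h3 : a - 1 ≠ 0 := sub_ne_zero.2 h1
  refine integrableOn_and_integral_eq_of_hasDerivAt
    (F := fun x => a ^ 2 / (a ^ 2 - 1) ^ 2 * (arctan x - arctan (x / a) / a) -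
      1 / (a ^ 2 - 1) * ((arctan x + x / (1 + x ^ 2)) / 2))
    (by simp) (fun x => ?_) (fun x _ => by positivity) ?_
  · refine ((((hasDerivAt_arctan x).sub
      (((hasDerivAt_id x).div_const a).arctan.div_const a)).const_mul
        (a ^ 2 / (a ^ 2 - 1) ^ 2)).sub ((((hasDerivAt_arctan x).add
          (hasDerivAt_div_one_add_sq x)).div_const 2).const_mul (1 / (a ^ 2 - 1)))).congr_deriv ?_
    have h4 : x ^ 2 + a ^ 2 ≠ 0 := by positivity
    have h5 : 1 + x ^ 2 ≠ 0 := by positivity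
    have h6 : 1 + (x / a) ^ 2 = (x ^ 2 + a ^ 2) / a ^ 2 := by field
    simp only [id, h6]
    field
  · have h := tendsto_arctan_atTop.mono_right (nhdsWithin_le_nhds (s := Iio (π / 2)))
    have h' := h.comp (tendsto_id.atTop_div_const ha)
    have hlim : π / (4 * (1 + a) ^ 2) = a ^ 2 / (a ^ 2 - 1) ^ 2 * (π / 2 - π / 2 / a) -
        1 / (a ^ 2 - 1) * ((π / 2 + 0) / 2) := by
      rw [show a ^ 2 - 1 = (a - 1) * (1 + a) by ring]
      have : 1 + a ≠ 0 := by positivity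
      field
    rw [hlim]
    exact ((h.sub (h'.div_const a)).const_mul (a ^ 2 / (a ^ 2 - 1) ^ 2)).sub
      (((h.add tendsto_div_one_add_sq_atTop).div_const 2).const_mul (1 / (a ^ 2 - 1)))

theorem two_pi_mul_lt_exp_sub_one {x : ℝ} (hx : 0 < x) : 2 * π * x < exp (2 * π * x) - 1 := by
  have := add_one_lt_exp (x := 2 * π * x) (by positivity)
  linarith

/-- The partial fraction expansion of the hyperbolic cotangent. -/
theorem hasSum_one_div_sq_add_sq {x : ℝ} (hx : 0 < x) :
    HasSum (fun n : ℕ => 1 / (x ^ 2 + ((n : ℝ) + 1) ^ 2))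
      (π / x * (1 / (exp (2 * π * x) - 1) + 1 / 2 - 1 / (2 * π * x))) := by
  have hz : (x * Complex.I : ℂ) ∈ Complex.integerComplement := by
    rintro ⟨n, hn⟩
    have := congrArg Complex.im hn
    simp at this
    exact hx.ne this
  have h := (summable_cotTerm hz).hasSum
  have hx' : (x : ℂ) ≠ 0 := by exact_mod_cast hx.ne'
  have hval : ∑' n, cotTerm (x * Complex.I) n =
      π * Complex.cot (π * (x * Complex.I)) - 1 / (x * Complex.I) := (cot_series_rep' hz).symm
  rw [hval, Complex.cot_pi_eq_exp_ratio] at h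
  have h' := h.mul_left (Complex.I / (2 * x))
  rw [← Complex.hasSum_ofReal]
  convert h' using 1
  · rfl
  · funext n
    rw [cotTerm_identity hz]
    have h1 : (x * Complex.I + (n + 1)) * (x * Complex.I - (n + 1)) =
        -((x : ℂ) ^ 2 + (n + 1) ^ 2) := by
      linear_combination (x : ℂ) ^ 2 * Complex.I_sq
    have h2 : (x : ℂ) ^ 2 + (n + 1) ^ 2 ≠ 0 := by
      have : x ^ 2 + ((n : ℝ) + 1) ^ 2 ≠ 0 := by positivity
      exact_mod_cast this
    rw [h1]
    push_cast
    field_simp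
    rw [Complex.I_sq]
    ring
  · have h1 : 2 * π * Complex.I * (x * Complex.I) = ((-(2 * π * x) : ℝ) : ℂ) := by
      push_cast
      linear_combination 2 * (π : ℂ) * x * Complex.I_sq
    rw [h1, ← Complex.ofReal_exp, exp_neg]
    have h2 : exp (2 * π * x) - 1 ≠ 0 := by
      have := two_pi_mul_lt_exp_sub_one hx
      have : 0 < 2 * π * x := by positivity
      linarith
    have h3 : (exp (2 * π * x) : ℂ) ≠ 0 := by exact_mod_cast (exp_pos _).ne'
    have h4 : ((exp (2 * π * x) : ℝ) : ℂ) - 1 ≠ 0 := by exact_mod_cast h2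
    have h5 : (π : ℂ) ≠ 0 := by exact_mod_cast pi_ne_zero
    generalize exp (2 * π * x) = E at *
    push_cast
    have h6 : 1 - (E : ℂ)⁻¹ = (E - 1) / E := by field
    rw [h6]
    field

theorem integral_div_exp_sub_one_mul_sq :
    (3 / 2 + 4 * ∫ x in Ioi (0 : ℝ), x / ((exp (2 * π * x) - 1) * (1 + x ^ 2) ^ 2)) =
      ∑' n : ℕ, 1 / (n : ℝ) ^ 2 := by
  have hF (n : ℕ) := integral_sq_div_one_add_sq_sq_mul (a := (n : ℝ) + 1) (by positivity)
  set F : ℕ → ℝ → ℝ := fun n x => x ^ 2 / ((1 + x ^ 2) ^ 2 * (x ^ 2 + ((n : ℝ) + 1) ^ 2))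
  have hs2 : Summable (fun n : ℕ => 1 / (n : ℝ) ^ 2) := Real.summable_one_div_nat_pow.2 one_lt_two
  have hval : (fun n : ℕ => ∫ x in Ioi (0 : ℝ), F n x) =
      fun n : ℕ => π / 4 * (1 / ((n + 2 : ℕ) : ℝ) ^ 2) := by
    funext n
    rw [(hF n).2]
    push_cast
    have : (1 : ℝ) + (n + 1) = n + 2 := by ring
    rw [this]
    field
  have hnorm : (fun n : ℕ => ∫ x in Ioi (0 : ℝ), ‖F n x‖) =
      fun n : ℕ => ∫ x in Ioi (0 : ℝ), F n x := by
    funext n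
    refine integral_congr_ae (.of_forall fun x => ?_)
    exact norm_of_nonneg (by positivity)
  have hsum2 : Summable (fun n : ℕ => π / 4 * (1 / ((n + 2 : ℕ) : ℝ) ^ 2)) :=
    ((summable_nat_add_iff 2).2 hs2).mul_left _
  have hsum := hasSum_integral_of_summable_integral_norm (fun n => (hF n).1)
    (by rw [hnorm, hval]; exact hsum2)
  have hT : IntegrableOn (fun x => ∑' n, F n x) (Ioi 0) := by
    by_contra hcon
    rw [integral_undef hcon, hval] at hsum
    have h0 := (hasSum_zero_iff_of_nonneg (fun n => by positivity)).1 hsum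
    have := congrFun h0 0
    simp [pi_ne_zero] at this
  have htsum : ∫ x in Ioi (0 : ℝ), ∑' n, F n x = π / 4 * (∑' n : ℕ, 1 / (n : ℝ) ^ 2 - 1) := by
    rw [← hsum.tsum_eq, hval, tsum_mul_left, ← hs2.sum_add_tsum_nat_add 2]
    simp [Finset.sum_range_succ]
  obtain ⟨hA, hA'⟩ := integral_inv_one_add_sq_sq
  obtain ⟨hB, hB'⟩ := integral_div_one_add_sq_sq
  have key : ∫ x in Ioi (0 : ℝ), x / ((exp (2 * π * x) - 1) * (1 + x ^ 2) ^ 2) =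
      ∫ x in Ioi (0 : ℝ), (1 / π * (∑' n, F n x) + 1 / (2 * π) * (1 / (1 + x ^ 2) ^ 2) -
        1 / 2 * (x / (1 + x ^ 2) ^ 2)) := by
    refine setIntegral_congr_fun measurableSet_Ioi fun x hx => ?_
    have hx : 0 < x := hx
    have h1 : ∑' n, F n x = x ^ 2 / (1 + x ^ 2) ^ 2 *
        (π / x * (1 / (exp (2 * π * x) - 1) + 1 / 2 - 1 / (2 * π * x))) := by
      rw [← (hasSum_one_div_sq_add_sq hx).tsum_eq, ← tsum_mul_left]
      refine tsum_congr fun n => ?_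
      simp only [F]
      field
    have h2 : exp (2 * π * x) - 1 ≠ 0 := by
      have := two_pi_mul_lt_exp_sub_one hx
      have : 0 < 2 * π * x := by positivity
      linarith
    simp only [h1]
    field
  have hTA : IntegrableOn
      (fun x => 1 / π * (∑' n, F n x) + 1 / (2 * π) * (1 / (1 + x ^ 2) ^ 2)) (Ioi 0) :=
    (hT.const_mul _).add (hA.const_mul _)
  rw [key, integral_sub hTA (hB.const_mul _), integral_add (hT.const_mul _) (hA.const_mul _),
    integral_const_mul, integral_const_mul, integral_const_mul, htsum, hA', hB']
  field

theorem sinh_sq_eq_exp (x : ℝ) :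
    sinh (π * x) ^ 2 = (exp (2 * π * x) - 1) ^ 2 / (4 * exp (2 * π * x)) := by
  have h : exp (2 * π * x) = exp (π * x) ^ 2 := by
    rw [← exp_nat_mul]
    ring_nf
  rw [sinh_eq, exp_neg, h]
  have := (exp_pos (π * x)).ne'
  field

theorem integral_sq_div_sinh_sq :
    π * ∫ x in Ioi (0 : ℝ), x ^ 2 / ((1 + x ^ 2) * sinh (π * x) ^ 2) =
      4 * ∫ x in Ioi (0 : ℝ), x / ((exp (2 * π * x) - 1) * (1 + x ^ 2) ^ 2) := by
  have hI : IntegrableOn (fun x : ℝ => x ^ 2 / ((1 + x ^ 2) * sinh (π * x) ^ 2)) (Ioi 0) := by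
    refine (integrable_inv_one_add_sq.integrableOn.const_mul (1 / π ^ 2)).mono'
      (Measurable.aestronglyMeasurable (by fun_prop)) ?_
    filter_upwards [ae_restrict_mem measurableSet_Ioi] with x hx
    have hx : 0 < x := hx
    have h : π * x ≤ sinh (π * x) := self_le_sinh_iff.2 (by positivity)
    have h0 : 0 < π * x := by positivity
    rw [norm_of_nonneg (by positivity)]
    calc x ^ 2 / ((1 + x ^ 2) * sinh (π * x) ^ 2) ≤ x ^ 2 / ((1 + x ^ 2) * (π * x) ^ 2) := by
          gcongr
      _ = 1 / π ^ 2 * (1 + x ^ 2)⁻¹ := by field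
  have hJ : IntegrableOn (fun x : ℝ => x / ((exp (2 * π * x) - 1) * (1 + x ^ 2) ^ 2))
      (Ioi 0) := by
    refine (integral_inv_one_add_sq_sq.1.const_mul (1 / (2 * π))).mono'
      (Measurable.aestronglyMeasurable (by fun_prop)) ?_
    filter_upwards [ae_restrict_mem measurableSet_Ioi] with x hx
    have hx : 0 < x := hx
    have h := two_pi_mul_lt_exp_sub_one hx
    have h0 : 0 < 2 * π * x := by positivity
    have h1 := h0.trans h
    rw [norm_of_nonneg (by positivity)]
    calc x / ((exp (2 * π * x) - 1) * (1 + x ^ 2) ^ 2) ≤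
          x / ((2 * π * x) * (1 + x ^ 2) ^ 2) := by gcongr
      _ = 1 / (2 * π) * (1 / (1 + x ^ 2) ^ 2) := by field
  set F : ℝ → ℝ := fun x => (1 - (1 + x ^ 2)⁻¹) * (exp (2 * π * x) - 1)⁻¹
  have hF0 : F 0 = 0 := by simp [F]
  have hFnn (x : ℝ) (hx : 0 ≤ x) : 0 ≤ F x := by
    have h1 : 1 - (1 + x ^ 2)⁻¹ = x ^ 2 / (1 + x ^ 2) := by field
    have h2 : 1 ≤ exp (2 * π * x) := one_le_exp (by positivity)
    simp only [F, h1]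
    exact mul_nonneg (by positivity) (inv_nonneg.2 (sub_nonneg.2 h2))
  have hFle (x : ℝ) (hx : 0 ≤ x) : F x ≤ x / (1 + x ^ 2) := by
    obtain rfl | hx := hx.eq_or_lt
    · simp [F]
    have h := two_pi_mul_lt_exp_sub_one hx
    have h0 : 0 < 2 * π * x := by positivity
    have h1 : 1 - (1 + x ^ 2)⁻¹ = x ^ 2 / (1 + x ^ 2) := by field
    have h2 : x ≤ exp (2 * π * x) - 1 := by nlinarith [pi_gt_three]
    simp only [F, h1]
    calc x ^ 2 / (1 + x ^ 2) * (exp (2 * π * x) - 1)⁻¹ ≤ x ^ 2 / (1 + x ^ 2) * x⁻¹ := by gcongr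
      _ = x / (1 + x ^ 2) := by field
  have hcont : ContinuousWithinAt F (Ici 0) 0 := by
    have h : Tendsto (fun x : ℝ => x / (1 + x ^ 2)) (𝓝[≥] 0) (𝓝 0) := by
      have := (hasDerivAt_div_one_add_sq 0).continuousAt.continuousWithinAt (s := Ici 0)
      simpa [ContinuousWithinAt] using this
    rw [ContinuousWithinAt, hF0]
    refine squeeze_zero' ?_ ?_ h
    · filter_upwards [self_mem_nhdsWithin] with x hx using hFnn x hx
    · filter_upwards [self_mem_nhdsWithin] with x hx using hFle x hx
  have hlim : Tendsto F atTop (𝓝 0) := by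
    refine squeeze_zero' ?_ ?_ tendsto_div_one_add_sq_atTop
    · filter_upwards [eventually_ge_atTop 0] with x hx using hFnn x hx
    · filter_upwards [eventually_ge_atTop 0] with x hx using hFle x hx
  have hderiv (x : ℝ) (hx : x ∈ Ioi (0 : ℝ)) : HasDerivAt F
      (2 * (x / ((exp (2 * π * x) - 1) * (1 + x ^ 2) ^ 2)) -
        π / 2 * (x ^ 2 / ((1 + x ^ 2) * sinh (π * x) ^ 2))) x := by
    have hx : 0 < x := hx
    have h := two_pi_mul_lt_exp_sub_one hx
    have h0 : 0 < 2 * π * x := by positivity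
    have h1 : exp (2 * π * x) - 1 ≠ 0 := (h0.trans h).ne'
    have h2 := (exp_pos (2 * π * x)).ne'
    refine (((hasDerivAt_inv_one_add_sq x).const_sub 1).mul
      ((((hasDerivAt_id x).const_mul (2 * π)).exp.sub_const 1).fun_inv h1)).congr_deriv ?_
    rw [sinh_sq_eq_exp]
    simp only [id]
    field
  have := integral_Ioi_of_hasDerivAt_of_tendsto hcont hderiv
    ((hJ.const_mul _).sub (hI.const_mul _)) hlim
  rw [integral_sub (hJ.const_mul _) (hI.const_mul _), integral_const_mul, integral_const_mul,
    hF0] at this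
  linarith

theorem zeta_two_eq_integral :
    riemannZeta 2 =
      ((3 / 2 + π * ∫ x in Ioi (0 : ℝ),
        x ^ 2 / ((1 + x ^ 2) * Real.sinh (π * x) ^ 2) : ℝ) : ℂ) ∧
    riemannZeta 2 =
      ((3 / 2 + 4 * ∫ x in Ioi (0 : ℝ),
        x / ((Real.exp (2 * π * x) - 1) * (1 + x ^ 2) ^ 2) : ℝ) : ℂ) := by
  rw [integral_sq_div_sinh_sq, and_self, integral_div_exp_sub_one_mul_sq]
  have h := zeta_nat_eq_tsum_of_gt_one one_lt_two
  push_cast at h ⊢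
  exact h
end

section
/- ζ(3) = 1 + π² ∫₀^∞ x³ cosh(πx) / ((1+x²) sinh³(πx)) dx, and also ζ(3) = 1 − 2 ∫₀^∞ x(x²−3) / ((e^{2πx} − 1)(1+x²)³) dx. -/
open Real MeasureTheory Set

theorem integrableOn_pow_mul_exp_neg_mul (n : ℕ) {a : ℝ} (ha : 0 < a) :
    IntegrableOn (fun t : ℝ ↦ t ^ n * exp (-a * t)) (Ioi 0) := by
  have h := integrableOn_rpow_mul_exp_neg_mul_rpow (p := 1) (s := n) (b := a)
    (by have := n.cast_nonneg (α := ℝ); linarith) one_pos ha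
  simpa using h

theorem integral_pow_mul_exp_neg_mul (n : ℕ) {a : ℝ} (ha : 0 < a) :
    ∫ t in Ioi (0 : ℝ), t ^ n * exp (-a * t) = n.factorial / a ^ (n + 1) := by
  have h := Real.integral_rpow_mul_exp_neg_mul_Ioi (a := n + 1) (r := a) (by positivity) ha
  rw [Real.Gamma_nat_eq_factorial] at h
  have h' : ((1 : ℝ) / a) ^ ((n : ℝ) + 1) = 1 / a ^ (n + 1) := by
    rw [← Nat.cast_succ, rpow_natCast, div_pow, one_pow]
  rw [h'] at h
  simp only [add_sub_cancel_right, rpow_natCast] at h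
  simp only [neg_mul, h]
  ring

open Filter Topology in
theorem integral_sq_mul_exp_neg_mul_sin (x : ℝ) :
    ∫ t in Ioi (0 : ℝ), t ^ 2 * exp (-t) * sin (x * t) = 2 * x * (3 - x ^ 2) / (1 + x ^ 2) ^ 3 := by
  set c : ℂ := 1 - x * Complex.I with hc
  have hc0 : c ≠ 0 := fun h ↦ by simpa [hc] using congrArg Complex.re h
  have hnorm (k : ℕ) (t : ℝ) : ‖(t : ℂ) ^ k * Complex.exp (-c * t)‖ = |t| ^ k * exp (-t) := by
    simp [Complex.norm_exp, hc]
  have hint : IntegrableOn (fun t : ℝ ↦ (t : ℂ) ^ 2 * Complex.exp (-c * t)) (Ioi 0) := by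
    have h := Real.GammaIntegral_convergent (s := 3) (by norm_num)
    refine h.mono' (by fun_prop) ((ae_restrict_mem measurableSet_Ioi).mono fun t ht ↦ ?_)
    rw [hnorm, abs_of_pos ht, mul_comm]
    norm_num
  have hlim (k : ℕ) : Tendsto (fun t : ℝ ↦ (t : ℂ) ^ k * Complex.exp (-c * t)) atTop (𝓝 0) := by
    rw [tendsto_zero_iff_norm_tendsto_zero]
    refine (tendsto_pow_mul_exp_neg_atTop_nhds_zero k).congr' ?_
    filter_upwards [eventually_gt_atTop 0] with t ht
    rw [hnorm, abs_of_pos ht]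
  have hderiv (t : ℝ) : HasDerivAt (fun t : ℝ ↦ (-(1 / c)) * ((t : ℂ) ^ 2 * Complex.exp (-c * t)) +
      ((-(2 / c ^ 2)) * ((t : ℂ) ^ 1 * Complex.exp (-c * t)) +
        (-(2 / c ^ 3)) * ((t : ℂ) ^ 0 * Complex.exp (-c * t))))
      ((t : ℂ) ^ 2 * Complex.exp (-c * t)) t := by
    have h1 : HasDerivAt (fun t : ℝ ↦ (t : ℂ)) 1 t := Complex.ofRealCLM.hasDerivAt
    have h2 := (h1.const_mul (-c)).cexp
    have h3 (k : ℕ) := (h1.pow k).mul h2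
    refine (((h3 2).const_mul (-(1 / c))).add (((h3 1).const_mul (-(2 / c ^ 2))).add
      ((h3 0).const_mul (-(2 / c ^ 3))))).congr_deriv ?_
    simp
    field_simp
    ring
  have h := integral_Ioi_of_hasDerivAt_of_tendsto (a := 0)
    (hderiv 0).continuousAt.continuousWithinAt (fun t _ ↦ hderiv t) hint
    (((hlim 2).const_mul _).add (((hlim 1).const_mul _).add ((hlim 0).const_mul _)))
  have h2 := integral_im hint
  rw [h] at h2
  have h3 (t : ℝ) : RCLike.im ((t : ℂ) ^ 2 * Complex.exp (-c * t)) =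
      t ^ 2 * exp (-t) * sin (x * t) := by
    rw [← Complex.ofReal_pow, RCLike.im_eq_complex_im, Complex.im_ofReal_mul]
    simp [Complex.exp_im, Complex.mul_im, hc, mul_assoc]
  simp only [h3] at h2
  rw [h2]
  have hx : (1 + x ^ 2 : ℂ) ≠ 0 := by
    norm_cast; positivity
  have e : 2 / c ^ 3 = ((2 * (1 - 3 * x ^ 2) / (1 + x ^ 2) ^ 3 : ℝ) : ℂ) +
      ((2 * x * (3 - x ^ 2) / (1 + x ^ 2) ^ 3 : ℝ) : ℂ) * Complex.I := by
    rw [div_eq_iff (by positivity)]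
    push_cast
    field_simp
    rw [hc]
    ring_nf
    simp only [Complex.I_sq, Complex.I_pow_three, Complex.I_pow_four]
    ring
  rw [RCLike.im_eq_complex_im]
  simp only [mul_zero, add_zero, zero_sub, Complex.ofReal_zero, Complex.exp_zero, e, pow_one,
    pow_zero, ne_eq, OfNat.ofNat_ne_zero, not_false_eq_true, zero_pow, mul_one, zero_add, neg_neg]
  rw [Complex.add_im, Complex.ofReal_im, Complex.im_ofReal_mul, Complex.I_im]
  ring

theorem integral_exp_neg_mul_mul_sin {a : ℝ} (ha : 0 < a) (t : ℝ) :
    ∫ x in Ioi (0 : ℝ), exp (-a * x) * sin (x * t) = t / (a ^ 2 + t ^ 2) := by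
  have hre : (-a + t * Complex.I : ℂ).re < 0 := by simpa
  have h := integral_exp_mul_complex_Ioi hre 0
  have h2 := integral_im (integrableOn_exp_mul_complex_Ioi hre 0)
  rw [h] at h2
  have h3 (x : ℝ) : RCLike.im (Complex.exp ((-a + t * Complex.I) * x)) =
      exp (-a * x) * sin (x * t) := by
    simp [Complex.exp_im, mul_comm]
  simp only [h3] at h2
  rw [h2]
  simp [Complex.normSq_apply, pow_two, neg_div]

theorem mul_exp_half_le_exp_sub_one {y : ℝ} (hy : 0 ≤ y) : y * exp (y / 2) ≤ exp y - 1 := by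
  have h := self_le_sinh_iff.2 (by positivity : 0 ≤ y / 2)
  have e : exp y - 1 = 2 * sinh (y / 2) * exp (y / 2) := by
    rw [sinh_eq, mul_div_cancel₀ _ two_ne_zero, sub_mul, ← exp_add, ← exp_add]
    simp
  rw [e]
  gcongr
  linarith

theorem hasSum_coth {t : ℝ} (ht : 0 < t) :
    HasSum (fun n : ℕ ↦ 2 * (t / ((2 * π * (n + 1)) ^ 2 + t ^ 2)))
      (1 / (exp t - 1) + 1 / 2 - 1 / t) := by
  obtain ⟨s, hs, rfl⟩ : ∃ s, 0 < s ∧ t = 2 * π * s :=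
    ⟨t / (2 * π), by positivity, by field_simp⟩
  have hz : (s * Complex.I : ℂ) ∈ Complex.integerComplement := by
    rintro ⟨n, hn⟩
    simpa [hs.ne] using congrArg Complex.im hn
  have hsum := (summable_cotTerm hz).hasSum.mul_left (Complex.I / (2 * π))
  unfold cotTerm at hsum
  rw [← cot_series_rep' hz] at hsum
  have hπ : (π : ℂ) ≠ 0 := by simp [pi_ne_zero]
  have hs' : (s : ℂ) ≠ 0 := by simp [hs.ne']
  have hterm (n : ℕ) : Complex.I / (2 * π) * (1 / (s * Complex.I - (n + 1)) +
      1 / (s * Complex.I + (n + 1))) =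
        ((2 * (2 * π * s / ((2 * π * (n + 1)) ^ 2 + (2 * π * s) ^ 2)) : ℝ) : ℂ) := by
    have h1 := Complex.integerComplement_add_ne_zero hz (n + 1)
    have h2 := Complex.integerComplement_add_ne_zero hz (-(n + 1))
    push_cast at h1 h2
    rw [← sub_eq_add_neg] at h2
    have h3 : ((n + 1) ^ 2 + s ^ 2 : ℂ) ≠ 0 := by
      norm_cast
      positivity
    have h4 : (s * Complex.I - (n + 1)) * (s * Complex.I + (n + 1)) =
        -((n + 1) ^ 2 + s ^ 2 : ℂ) := by
      linear_combination (s ^ 2 : ℂ) * Complex.I_sq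
    rw [one_div_add_one_div h2 h1, h4]
    push_cast
    rw [show ((2 * π * (n + 1)) ^ 2 + (2 * π * s) ^ 2 : ℂ) =
      (2 * π) ^ 2 * ((n + 1) ^ 2 + s ^ 2) by ring]
    field_simp
    linear_combination (-2 * s : ℂ) * Complex.I_sq
  have hval : Complex.I / (2 * π) * (π * Complex.cot (π * (s * Complex.I)) - 1 / (s * Complex.I)) =
      ((1 / (exp (2 * π * s) - 1) + 1 / 2 - 1 / (2 * π * s) : ℝ) : ℂ) := by
    have hexp : Complex.exp (2 * π * Complex.I * (s * Complex.I)) =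
        ((exp (2 * π * s))⁻¹ : ℝ) := by
      rw [← Real.exp_neg, Complex.ofReal_exp]
      congr 1
      push_cast
      linear_combination (2 * π * s : ℂ) * Complex.I_sq
    rw [Complex.cot_pi_eq_exp_ratio, hexp]
    have hlt : 1 < exp (2 * π * s) := one_lt_exp_iff.2 ht
    generalize exp (2 * π * s) = E at hlt
    have hE : (E : ℂ) ≠ 0 := by norm_cast; linarith
    have hE1 : (E : ℂ) - 1 ≠ 0 := by norm_cast; linarith
    push_cast
    rw [show 1 - (E : ℂ)⁻¹ = (E - 1) / E by field_simp]
    field_simp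
    ring
  simp only [hterm, hval] at hsum
  exact Complex.hasSum_ofReal.1 hsum

theorem hasSum_exp_neg_succ_mul {y : ℝ} (hy : 0 < y) :
    HasSum (fun n : ℕ ↦ exp (-((n + 1) * y))) (1 / (exp y - 1)) := by
  have h := (hasSum_geometric_of_lt_one (exp_pos (-y)).le (by simpa using hy)).mul_left (exp (-y))
  have hval : exp (-y) * (1 - exp (-y))⁻¹ = 1 / (exp y - 1) := by
    have : exp y - 1 ≠ 0 := (sub_pos.2 (one_lt_exp_iff.2 hy)).ne'
    have h' : 1 - exp (-y) = (exp y - 1) * exp (-y) := by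
      rw [sub_mul, ← exp_add]
      simp
    rw [h']
    field_simp
  have hterm (n : ℕ) : exp (-y) * exp (-y) ^ n = exp (-((n + 1) * y)) := by
    rw [← exp_nat_mul, ← exp_add]
    ring_nf
  simpa only [hval, hterm] using h

theorem summable_div_mul_succ_sq (K c : ℝ) : Summable fun n : ℕ ↦ K / (c * (n + 1)) ^ 2 := by
  have h := ((summable_nat_add_iff 1).2 (Real.summable_one_div_nat_pow.2 one_lt_two)).mul_left
    (K / c ^ 2)
  refine h.congr fun n ↦ ?_
  push_cast
  rw [mul_pow, div_mul_div_comm, mul_one]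

section

variable {f : ℝ → ℝ} {K c : ℝ}

theorem integrableOn_mul_exp_neg_mul (hf : Measurable f) (hK : ∀ x, 0 < x → |f x| ≤ K * x)
    (hc : 0 < c) : IntegrableOn (fun x ↦ f x * exp (-c * x)) (Ioi 0) := by
  refine ((integrableOn_pow_mul_exp_neg_mul 1 hc).const_mul K).mono' (by fun_prop)
    ((ae_restrict_mem measurableSet_Ioi).mono fun x hx ↦ ?_)
  rw [norm_mul, norm_eq_abs, norm_of_nonneg (exp_pos _).le, pow_one, ← mul_assoc]
  gcongr
  exact hK x hx

theorem integral_norm_mul_exp_neg_mul_le (hf : Measurable f) (hK : ∀ x, 0 < x → |f x| ≤ K * x)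
    (hc : 0 < c) : ∫ x in Ioi 0, ‖f x * exp (-c * x)‖ ≤ K / c ^ 2 := by
  calc
    _ ≤ ∫ x in Ioi 0, K * (x ^ 1 * exp (-c * x)) := by
      refine setIntegral_mono_on (integrableOn_mul_exp_neg_mul hf hK hc).norm
        ((integrableOn_pow_mul_exp_neg_mul 1 hc).const_mul K) measurableSet_Ioi fun x hx ↦ ?_
      rw [norm_mul, norm_eq_abs, norm_of_nonneg (exp_pos _).le, pow_one, ← mul_assoc]
      gcongr
      exact hK x hx
    _ = _ := by
      rw [integral_const_mul, integral_pow_mul_exp_neg_mul 1 hc]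
      simp
      ring

theorem hasSum_integral_mul_exp_neg (hf : Measurable f) (hK : ∀ x, 0 < x → |f x| ≤ K * x)
    (hc : 0 < c) : HasSum (fun n : ℕ ↦ ∫ x in Ioi 0, f x * exp (-(c * (n + 1)) * x))
      (∫ x in Ioi 0, f x / (exp (c * x) - 1)) := by
  have hpos (n : ℕ) : 0 < c * (n + 1) := by positivity
  have h := hasSum_integral_of_summable_integral_norm
    (fun n : ℕ ↦ integrableOn_mul_exp_neg_mul hf hK (hpos n))
    (Summable.of_nonneg_of_le (fun n ↦ by positivity)
      (fun n ↦ integral_norm_mul_exp_neg_mul_le hf hK (hpos n)) (summable_div_mul_succ_sq K c))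
  have hval : ∫ x in Ioi 0, f x / (exp (c * x) - 1) =
      ∫ x in Ioi 0, ∑' n : ℕ, f x * exp (-(c * (n + 1)) * x) := by
    refine setIntegral_congr_fun measurableSet_Ioi fun x hx ↦ ?_
    have := ((hasSum_exp_neg_succ_mul (mul_pos hc hx)).mul_left (f x)).tsum_eq
    rw [div_eq_mul_one_div, ← this]
    congr! 4
    ring
  rwa [hval]

theorem integrableOn_div_exp_sub_one (hf : Measurable f) (hK : ∀ x, 0 < x → |f x| ≤ K * x)
    (hc : 0 < c) : IntegrableOn (fun x ↦ f x / (exp (c * x) - 1)) (Ioi 0) := by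
  refine ((integrableOn_pow_mul_exp_neg_mul 0 (half_pos hc)).const_mul (K / c)).mono'
    (hf.div (by fun_prop)).aestronglyMeasurable
    ((ae_restrict_mem measurableSet_Ioi).mono fun x hx ↦ ?_)
  have hx : 0 < x := hx
  have hy := mul_pos hc hx
  have h1 := mul_exp_half_le_exp_sub_one hy.le
  have h2 : 0 < exp (c * x) - 1 := sub_pos.2 (one_lt_exp_iff.2 hy)
  have h3 : 0 ≤ K * x := (abs_nonneg _).trans (hK x hx)
  rw [norm_div, norm_of_nonneg h2.le, norm_eq_abs]
  calc
    _ ≤ K * x / (c * x * exp (c * x / 2)) := by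
      gcongr
      exact hK x hx
    _ = _ := by
      rw [show -(c / 2) * x = -(c * x / 2) by ring, exp_neg]
      field_simp

end

theorem integral_mul_exp_neg_mul_eq {a : ℝ} (ha : 0 < a) :
    ∫ x in Ioi (0 : ℝ), 2 * x * (3 - x ^ 2) / (1 + x ^ 2) ^ 3 * exp (-a * x) =
      ∫ t in Ioi (0 : ℝ), t ^ 2 * exp (-t) * (t / (a ^ 2 + t ^ 2)) := by
  have hint : Integrable (Function.uncurry fun x t : ℝ ↦
      exp (-a * x) * (t ^ 2 * exp (-t)) * sin (x * t))
      ((volume.restrict (Ioi 0)).prod (volume.restrict (Ioi 0))) := by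
    have h1 := integrableOn_pow_mul_exp_neg_mul 0 ha
    have h2 := integrableOn_pow_mul_exp_neg_mul 2 one_pos
    simp only [pow_zero, one_mul, neg_mul] at h1 h2
    refine (h1.mul_prod h2).mono (by fun_prop) (ae_of_all _ fun p ↦ ?_)
    simp only [Function.uncurry, norm_mul, neg_mul]
    exact mul_le_of_le_one_right (by positivity) (abs_sin_le_one _)
  have h := integral_integral_swap hint
  convert h using 1
  · refine integral_congr_ae (ae_of_all _ fun x ↦ ?_)
    simp only [mul_assoc]
    rw [integral_const_mul]
    simp only [← mul_assoc]
    rw [integral_sq_mul_exp_neg_mul_sin, mul_comm]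
  · refine integral_congr_ae (ae_of_all _ fun t ↦ ?_)
    simp only [← integral_exp_neg_mul_mul_sin ha]
    rw [← integral_const_mul]
    congr! 2
    ring

theorem hasSum_integral_coth :
    HasSum (fun n : ℕ ↦ ∫ t in Ioi (0 : ℝ), t ^ 2 * exp (-t) * (t / ((2 * π * (n + 1)) ^ 2 + t ^ 2)))
      (∫ t in Ioi (0 : ℝ), t ^ 2 * exp (-t) / 2 * (1 / (exp t - 1) + 1 / 2 - 1 / t)) := by
  have hle (n : ℕ) : ∀ t ∈ Ioi (0 : ℝ), ‖t ^ 2 * exp (-t) * (t / ((2 * π * (n + 1)) ^ 2 + t ^ 2))‖ ≤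
      1 / (2 * π * (n + 1)) ^ 2 * (t ^ 3 * exp (-1 * t)) := by
    intro t ht
    have ht : 0 < t := ht
    rw [norm_of_nonneg (by positivity)]
    calc
      _ ≤ t ^ 2 * exp (-t) * (t / ((2 * π * (n + 1)) ^ 2)) := by
        gcongr
        linarith [sq_nonneg t]
      _ = _ := by
        rw [neg_one_mul]
        ring
  have hi (n : ℕ) := (integrableOn_pow_mul_exp_neg_mul 3 one_pos).const_mul
    (1 / (2 * π * (n + 1)) ^ 2)
  have hi' (n : ℕ) : IntegrableOn (fun t : ℝ ↦
      t ^ 2 * exp (-t) * (t / ((2 * π * (n + 1)) ^ 2 + t ^ 2))) (Ioi 0) :=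
    (hi n).mono' (by fun_prop) ((ae_restrict_mem measurableSet_Ioi).mono (hle n))
  have h := hasSum_integral_of_summable_integral_norm hi'
    (Summable.of_nonneg_of_le (fun n ↦ by positivity)
      (fun n ↦ (setIntegral_mono_on (hi' n).norm (hi n) measurableSet_Ioi (hle n)).trans_eq
        (integral_const_mul _ _)) ((summable_div_mul_succ_sq 1 (2 * π)).mul_right _))
  have hval : ∫ t in Ioi (0 : ℝ), t ^ 2 * exp (-t) / 2 * (1 / (exp t - 1) + 1 / 2 - 1 / t) =
      ∫ t in Ioi (0 : ℝ), ∑' n : ℕ, t ^ 2 * exp (-t) * (t / ((2 * π * (n + 1)) ^ 2 + t ^ 2)) := by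
    refine setIntegral_congr_fun measurableSet_Ioi fun t ht ↦ ?_
    have := ((hasSum_coth ht).mul_left (t ^ 2 * exp (-t) / 2)).tsum_eq
    rw [← this]
    congr! 2
    ring
  rwa [hval]

theorem riemannZeta_three_eq_ofReal_tsum :
    riemannZeta 3 = ((∑' n : ℕ, 1 / (n : ℝ) ^ 3 : ℝ) : ℂ) := by
  have := zeta_nat_eq_tsum_of_gt_one (k := 3) (by norm_num)
  push_cast at this ⊢
  exact this

theorem hasSum_one_div_add_two_pow_three :
    HasSum (fun n : ℕ ↦ 1 / ((n : ℝ) + 2) ^ 3) (∑' n : ℕ, 1 / (n : ℝ) ^ 3 - 1) := by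
  have hs : Summable fun n : ℕ ↦ 1 / (n : ℝ) ^ 3 := Real.summable_one_div_nat_pow.2 (by norm_num)
  have h := (hasSum_nat_add_iff' 2).2 hs.hasSum
  simpa [Finset.sum_range_succ] using h

theorem abs_sq_mul_exp_neg_le (t : ℝ) (ht : 0 < t) : |t ^ 2 * exp (-t)| ≤ 1 * t := by
  rw [abs_of_pos (by positivity), exp_neg, ← div_eq_mul_inv, div_le_iff₀ (exp_pos _)]
  nlinarith [add_one_le_exp t]

theorem integral_sq_mul_exp_neg_mul_coth :
    ∫ t in Ioi (0 : ℝ), t ^ 2 * exp (-t) / 2 * (1 / (exp t - 1) + 1 / 2 - 1 / t) =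
      ∑' n : ℕ, 1 / (n : ℝ) ^ 3 - 1 := by
  have hm : Measurable fun t : ℝ ↦ t ^ 2 * exp (-t) := by fun_prop
  have h := hasSum_integral_mul_exp_neg hm abs_sq_mul_exp_neg_le one_pos
  have hi := integrableOn_div_exp_sub_one hm abs_sq_mul_exp_neg_le one_pos
  have hterm (n : ℕ) : ∫ t in Ioi (0 : ℝ), t ^ 2 * exp (-t) * exp (-(1 * (n + 1)) * t) =
      2 * (1 / ((n : ℝ) + 2) ^ 3) := by
    have := integral_pow_mul_exp_neg_mul 2 (by positivity : (0 : ℝ) < n + 2)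
    rw [mul_one_div]
    refine (integral_congr_ae (ae_of_all _ fun t ↦ ?_)).trans this
    rw [mul_assoc, ← exp_add]
    ring_nf
  simp only [hterm] at h
  simp only [one_mul] at h hi
  have hval := h.unique (hasSum_one_div_add_two_pow_three.mul_left 2)
  have h2 := integrableOn_pow_mul_exp_neg_mul 2 one_pos
  have h1 := integrableOn_pow_mul_exp_neg_mul 1 one_pos
  have hsplit : ∀ t ∈ Ioi (0 : ℝ), t ^ 2 * exp (-t) / 2 * (1 / (exp t - 1) + 1 / 2 - 1 / t) =
      1 / 2 * (t ^ 2 * exp (-t) / (exp t - 1)) + 1 / 4 * (t ^ 2 * exp (-1 * t)) -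
        1 / 2 * (t ^ 1 * exp (-1 * t)) := by
    intro t ht
    have ht : 0 < t := ht
    rw [neg_one_mul]
    field_simp
    ring
  rw [setIntegral_congr_fun measurableSet_Ioi hsplit, integral_sub, integral_add,
    integral_const_mul, integral_const_mul, integral_const_mul, hval,
    integral_pow_mul_exp_neg_mul 2 one_pos, integral_pow_mul_exp_neg_mul 1 one_pos]
  · norm_num
    ring
  · exact hi.const_mul _
  · exact h2.const_mul _
  · exact (hi.const_mul _).add (h2.const_mul _)
  · exact h1.const_mul _

theorem abs_two_mul_mul_div_le (x : ℝ) (hx : 0 < x) :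
    |2 * x * (3 - x ^ 2) / (1 + x ^ 2) ^ 3| ≤ 6 * x := by
  rw [abs_div, abs_of_pos (by positivity : 0 < (1 + x ^ 2) ^ 3), div_le_iff₀ (by positivity),
    abs_mul, abs_of_pos (by positivity : 0 < 2 * x)]
  have h1 : |3 - x ^ 2| ≤ 3 * (1 + x ^ 2) := abs_le.2 ⟨by nlinarith, by nlinarith⟩
  have h2 : 1 + x ^ 2 ≤ (1 + x ^ 2) ^ 3 := le_self_pow₀ (by nlinarith) (by norm_num)
  calc
    _ ≤ 2 * x * (3 * (1 + x ^ 2) ^ 3) := by gcongr; linarith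
    _ = _ := by ring

theorem integral_hermite :
    ∫ x in Ioi (0 : ℝ), 2 * x * (3 - x ^ 2) / (1 + x ^ 2) ^ 3 / (exp (2 * π * x) - 1) =
      ∑' n : ℕ, 1 / (n : ℝ) ^ 3 - 1 := by
  have h := hasSum_integral_mul_exp_neg (by fun_prop) abs_two_mul_mul_div_le two_pi_pos
  rw [← integral_sq_mul_exp_neg_mul_coth]
  refine h.unique ?_
  convert hasSum_integral_coth using 2 with n
  exact integral_mul_exp_neg_mul_eq (by positivity)

theorem div_sinh_le {y : ℝ} (hy : 0 < y) : y / sinh y ≤ 2 * exp (-(y / 2)) := by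
  have h1 := self_le_sinh_iff.2 (half_pos hy).le
  have h2 : exp (y / 2) / 2 ≤ cosh (y / 2) := by
    rw [cosh_eq]
    linarith [exp_pos (-(y / 2))]
  have h3 : sinh y = 2 * sinh (y / 2) * cosh (y / 2) := by
    rw [← sinh_two_mul, mul_div_cancel₀ _ two_ne_zero]
  have h4 : y / 2 * (exp (y / 2) / 2) ≤ sinh (y / 2) * cosh (y / 2) := by gcongr
  rw [div_le_iff₀ (sinh_pos_iff.2 hy), h3, exp_neg, mul_assoc, ← div_eq_inv_mul,
    mul_div_assoc', le_div_iff₀ (exp_pos _)]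
  linarith

theorem exp_two_mul_sub_one_eq (y : ℝ) : exp (2 * y) - 1 = 2 * sinh y * exp y := by
  rw [sinh_eq, mul_div_cancel₀ _ two_ne_zero, sub_mul, ← exp_add, ← exp_add]
  simp [two_mul]

theorem integrableOn_pow_three_mul_cosh_div :
    IntegrableOn (fun x : ℝ ↦ x ^ 3 * cosh (π * x) / ((1 + x ^ 2) * sinh (π * x) ^ 3)) (Ioi 0) := by
  refine ((integrableOn_pow_mul_exp_neg_mul 0 (half_pos pi_pos)).const_mul (8 / π ^ 3)).mono'
    (Measurable.aestronglyMeasurable (by fun_prop))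
    ((ae_restrict_mem measurableSet_Ioi).mono fun x hx ↦ ?_)
  have hx : 0 < x := hx
  have hy : 0 < π * x := by positivity
  have hs := sinh_pos_iff.2 hy
  have hc := cosh_pos (π * x)
  have hce : cosh (π * x) ≤ exp (π * x) := by
    rw [← cosh_add_sinh]
    linarith
  rw [norm_of_nonneg (by positivity)]
  calc
    _ ≤ x ^ 3 * exp (π * x) / (1 * sinh (π * x) ^ 3) := by
      gcongr
      nlinarith
    _ = (π * x / sinh (π * x)) ^ 3 * exp (π * x) / π ^ 3 := by
      field_simp
    _ ≤ (2 * exp (-(π * x / 2))) ^ 3 * exp (π * x) / π ^ 3 := by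
      gcongr
      exact div_sinh_le hy
    _ = _ := by
      have : exp (-(π * x / 2)) ^ 3 * exp (π * x) = exp (-(π / 2) * x) := by
        rw [← exp_nat_mul, ← exp_add]
        congr 1
        push_cast
        ring
      rw [← this]
      ring

/-- A primitive of the difference of the two integrands. -/
noncomputable def sinhPrimitive (x : ℝ) : ℝ :=
  -(π / 2) * (x ^ 3 / (1 + x ^ 2)) / sinh (π * x) ^ 2 -
    (3 * x ^ 2 + x ^ 4) / (1 + x ^ 2) ^ 2 / (exp (2 * π * x) - 1)

theorem hasDerivAt_sinhPrimitive {x : ℝ} (hx : 0 < x) :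
    HasDerivAt sinhPrimitive
      (π ^ 2 * (x ^ 3 * cosh (π * x) / ((1 + x ^ 2) * sinh (π * x) ^ 3)) -
        2 * x * (3 - x ^ 2) / (1 + x ^ 2) ^ 3 / (exp (2 * π * x) - 1)) x := by
  have hs : 0 < sinh (π * x) := sinh_pos_iff.2 (by positivity)
  have hE : exp (2 * π * x) - 1 = 2 * sinh (π * x) * exp (π * x) := by
    rw [mul_assoc, exp_two_mul_sub_one_eq]
  have hE0 : exp (2 * π * x) - 1 ≠ 0 := by rw [hE]; positivity
  have hq : HasDerivAt (fun x : ℝ ↦ 1 + x ^ 2) (2 * x) x := by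
    simpa using (hasDerivAt_pow 2 x).const_add 1
  have hq0 : 1 + x ^ 2 ≠ 0 := by positivity
  have h1 := (((hasDerivAt_pow 3 x).div hq hq0).const_mul (-(π / 2))).div
    ((((hasDerivAt_id x).const_mul π).sinh).pow 2) (pow_ne_zero 2 hs.ne')
  have h2 := ((((hasDerivAt_pow 2 x).const_mul 3).add (hasDerivAt_pow 4 x)).div (hq.pow 2)
    (pow_ne_zero 2 hq0)).div
    ((((hasDerivAt_id x).const_mul (2 * π)).exp).sub_const 1) hE0
  refine (h1.sub h2).congr_deriv ?_
  have hE' : exp (2 * π * x) = exp (π * x) ^ 2 := by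
    rw [← exp_nat_mul]
    congr 1
    push_cast
    ring
  have := exp_pos (π * x)
  simp only [id]
  simp
  rw [hE, hE']
  field_simp
  ring

theorem abs_sinhPrimitive_le {x : ℝ} (hx : 0 ≤ x) : |sinhPrimitive x| ≤ 2 * (x ^ 1 * exp (-x)) := by
  obtain rfl | hx := hx.eq_or_lt
  · simp [sinhPrimitive]
  have hy : 0 < π * x := by positivity
  have hs := sinh_pos_iff.2 hy
  have hE := mul_exp_half_le_exp_sub_one (by positivity : 0 ≤ 2 * π * x)
  rw [show 2 * π * x / 2 = π * x by ring] at hE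
  have hE0 : 0 < exp (2 * π * x) - 1 := lt_of_lt_of_le (by positivity) hE
  have hexp : exp (-(π * x)) ≤ exp (-x) := by
    gcongr
    nlinarith [pi_gt_three]
  have h1 : π / 2 * (x ^ 3 / (1 + x ^ 2)) / sinh (π * x) ^ 2 ≤ 2 / π * (x * exp (-(π * x))) := by
    calc
      _ ≤ π / 2 * (x ^ 3 / 1) / sinh (π * x) ^ 2 := by
        gcongr
        nlinarith
      _ = (π * x / sinh (π * x)) ^ 2 * (x / (2 * π)) := by
        field_simp
      _ ≤ (2 * exp (-(π * x / 2))) ^ 2 * (x / (2 * π)) := by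
        gcongr
        exact div_sinh_le hy
      _ = _ := by
        rw [mul_pow, ← exp_nat_mul]
        push_cast
        rw [show 2 * -(π * x / 2) = -(π * x) by ring]
        field_simp
  have h2 : (3 * x ^ 2 + x ^ 4) / (1 + x ^ 2) ^ 2 / (exp (2 * π * x) - 1) ≤
      3 / (2 * π) * (x * exp (-(π * x))) := by
    calc
      _ ≤ 3 * x ^ 2 / (2 * π * x * exp (π * x)) := by
        gcongr
        rw [div_le_iff₀ (by positivity)]
        nlinarith [sq_nonneg (x ^ 2), pow_pos hx 2, pow_pos hx 4, pow_pos hx 6]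
      _ = _ := by
        rw [exp_neg]
        field_simp
  have h3 : 2 / π + 3 / (2 * π) ≤ 2 := by
    rw [div_add_div _ _ (by positivity) (by positivity), div_le_iff₀ (by positivity)]
    nlinarith [pi_gt_three]
  rw [sinhPrimitive, neg_mul, neg_div, ← neg_add', abs_neg, abs_of_nonneg (by positivity), pow_one]
  calc
    _ ≤ (2 / π + 3 / (2 * π)) * (x * exp (-(π * x))) := by linarith
    _ ≤ 2 * (x * exp (-x)) := by gcongr

open Filter Topology in
theorem integral_cosh_div_sinh_pow_three :
    π ^ 2 * ∫ x in Ioi (0 : ℝ), x ^ 3 * cosh (π * x) / ((1 + x ^ 2) * sinh (π * x) ^ 3) =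
      ∫ x in Ioi (0 : ℝ), 2 * x * (3 - x ^ 2) / (1 + x ^ 2) ^ 3 / (exp (2 * π * x) - 1) := by
  have hi1 := integrableOn_pow_three_mul_cosh_div.const_mul (π ^ 2)
  have hi2 := integrableOn_div_exp_sub_one (by fun_prop) abs_two_mul_mul_div_le two_pi_pos
  have h0 : sinhPrimitive 0 = 0 := by simp [sinhPrimitive]
  have hcont : ContinuousWithinAt sinhPrimitive (Ici 0) 0 := by
    rw [ContinuousWithinAt, h0]
    refine squeeze_zero_norm' (eventually_mem_nhdsWithin.mono fun x hx ↦ abs_sinhPrimitive_le hx) ?_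
    have : Continuous fun x : ℝ ↦ 2 * (x ^ 1 * exp (-x)) := by fun_prop
    simpa using (this.tendsto 0).mono_left nhdsWithin_le_nhds
  have hlim : Tendsto sinhPrimitive atTop (𝓝 0) := by
    refine squeeze_zero_norm' ((eventually_ge_atTop 0).mono fun x hx ↦ abs_sinhPrimitive_le hx) ?_
    simpa using (tendsto_pow_mul_exp_neg_atTop_nhds_zero 1).const_mul 2
  have h := integral_Ioi_of_hasDerivAt_of_tendsto hcont
    (fun x hx ↦ hasDerivAt_sinhPrimitive hx) (hi1.sub hi2) hlim
  rw [integral_sub hi1 hi2, integral_const_mul, h0, sub_zero] at h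
  exact sub_eq_zero.1 h

theorem zeta_three_eq_integral :
    riemannZeta 3 =
      ((1 + π ^ 2 * ∫ x in Ioi (0 : ℝ),
        x ^ 3 * Real.cosh (π * x) / ((1 + x ^ 2) * Real.sinh (π * x) ^ 3) : ℝ) : ℂ) ∧
    riemannZeta 3 =
      ((1 - 2 * ∫ x in Ioi (0 : ℝ),
        x * (x ^ 2 - 3) / ((Real.exp (2 * π * x) - 1) * (1 + x ^ 2) ^ 3) : ℝ) : ℂ) := by
  constructor
  · rw [integral_cosh_div_sinh_pow_three, integral_hermite, riemannZeta_three_eq_ofReal_tsum]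
    congr 1
    ring
  · have h : -2 * ∫ x in Ioi (0 : ℝ),
        x * (x ^ 2 - 3) / ((Real.exp (2 * π * x) - 1) * (1 + x ^ 2) ^ 3) =
          ∑' n : ℕ, 1 / (n : ℝ) ^ 3 - 1 := by
      rw [← integral_hermite, ← integral_const_mul]
      congr 1 with x
      rw [div_div, mul_comm ((1 + x ^ 2) ^ 3)]
      ring
    rw [riemannZeta_three_eq_ofReal_tsum]
    congr 1
    linarith
end

section
/- ζ(4) = 5/6 + (π³/3) ∫₀^∞ x⁴ (2 + cosh(2πx)) / ((1+x²) sinh⁴(πx)) dx, and also ζ(4) = 5/6 − 8 ∫₀^∞ x(x²−1) / ((e^{2πx} − 1)(1+x²)⁴) dx. -/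
open Real MeasureTheory Set

theorem hasSum_pi_mul_coth_sub_inv {x : ℝ} (hx : 0 < x) :
    HasSum (fun n : ℕ => 2 * x / (x ^ 2 + ((n : ℝ) + 1) ^ 2))
      (π * (cosh (π * x) / sinh (π * x)) - 1 / x) := by
  have hz : (x : ℂ) * Complex.I ∈ Complex.integerComplement := by
    rintro ⟨k, hk⟩
    have := congrArg Complex.im hk
    simp at this
    exact hx.ne this
  have h := (summable_cotTerm hz).hasSum
  have hS : sinh (π * x) ≠ 0 := (sinh_pos_iff.2 (by positivity)).ne'
  have hS' : Complex.sinh (π * x) ≠ 0 := by exact_mod_cast hS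
  have hx' : (x : ℂ) ≠ 0 := by exact_mod_cast hx.ne'
  have key := cot_series_rep' hz
  simp only [cotTerm] at h
  rw [← key] at h
  have h2 := h.mul_left Complex.I
  rw [← Complex.hasSum_ofReal]
  convert! h2 using 1
  · funext n
    have := cotTerm_identity hz n
    simp only [cotTerm] at this
    rw [this]
    have e : ((x : ℂ) * Complex.I + (n + 1)) * (x * Complex.I - (n + 1)) =
        -((x : ℂ) ^ 2 + (n + 1) ^ 2) := by
      linear_combination (x : ℂ) ^ 2 * Complex.I_sq
    have h0 : (x : ℂ) ^ 2 + ((n : ℂ) + 1) ^ 2 ≠ 0 := by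
      have : x ^ 2 + ((n : ℝ) + 1) ^ 2 ≠ 0 := by positivity
      exact_mod_cast this
    rw [e]
    push_cast
    field_simp
    simp
  · rw [Complex.cot, ← mul_assoc (π : ℂ), Complex.cos_mul_I, Complex.sin_mul_I]
    push_cast
    field_simp

theorem integrableOn_inv_one_add_sq_pow {k : ℕ} (hk : k ≠ 0) :
    IntegrableOn (fun x : ℝ => ((1 + x ^ 2) ^ k)⁻¹) (Ioi 0) := by
  refine (integrable_inv_one_add_sq.integrableOn (s := Ioi 0)).mono' (by fun_prop) ?_
  filter_upwards with x
  have h1 : 1 ≤ 1 + x ^ 2 := by nlinarith [sq_nonneg x]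
  rw [norm_of_nonneg (by positivity)]
  gcongr
  exact le_self_pow₀ h1 hk

theorem integral_Ioi_inv_one_add_sq_pow_succ {k : ℕ} (hk : k ≠ 0) :
    (∫ x in Ioi (0 : ℝ), ((1 + x ^ 2) ^ (k + 1))⁻¹) =
      (2 * (k : ℝ) - 1) / (2 * k) * ∫ x in Ioi (0 : ℝ), ((1 + x ^ 2) ^ k)⁻¹ := by
  have hd : ∀ x ∈ Ici (0 : ℝ), HasDerivAt (fun x : ℝ => x / (1 + x ^ 2) ^ k)
      (2 * (k : ℝ) * ((1 + x ^ 2) ^ (k + 1))⁻¹ - (2 * (k : ℝ) - 1) * ((1 + x ^ 2) ^ k)⁻¹) x := by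
    intro x _
    have h0 : 1 + x ^ 2 ≠ 0 := by positivity
    obtain ⟨j, rfl⟩ := Nat.exists_eq_succ_of_ne_zero hk
    refine ((hasDerivAt_id x).div ((((hasDerivAt_id x).pow 2).const_add 1).pow (j + 1))
      (pow_ne_zero _ h0)).congr_deriv ?_
    simp only [id, Nat.succ_eq_add_one, Nat.add_sub_cancel, pow_succ, Pi.pow_apply]
    push_cast
    field_simp
    ring
  have i1 := (integrableOn_inv_one_add_sq_pow (Nat.succ_ne_zero k)).const_mul (2 * k : ℝ)
  have i2 := (integrableOn_inv_one_add_sq_pow hk).const_mul (2 * k - 1 : ℝ)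
  have hl : Filter.Tendsto (fun x : ℝ => x / (1 + x ^ 2) ^ k) Filter.atTop (nhds 0) := by
    refine squeeze_zero' ?_ ?_ tendsto_inv_atTop_zero
    · filter_upwards [Filter.eventually_gt_atTop 0] with x hx
      positivity
    · filter_upwards [Filter.eventually_gt_atTop 0] with x hx
      have h1 : 1 ≤ 1 + x ^ 2 := by nlinarith [sq_nonneg x]
      have h2 : 1 + x ^ 2 ≤ (1 + x ^ 2) ^ k := le_self_pow₀ h1 hk
      rw [inv_eq_one_div, div_le_div_iff₀ (by positivity) hx]
      nlinarith
  have h := integral_Ioi_of_hasDerivAt_of_tendsto' hd (i1.sub i2) hl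
  rw [integral_sub i1 i2, integral_const_mul, integral_const_mul] at h
  have hk' : (k : ℝ) ≠ 0 := by exact_mod_cast hk
  simp only [ne_eq, OfNat.ofNat_ne_zero, not_false_eq_true, zero_pow, add_zero, one_pow, div_one,
    sub_zero] at h
  rw [div_mul_eq_mul_div, eq_div_iff (by positivity)]
  linarith

theorem integral_Ioi_inv_one_add_sq_pow_one_to_five :
    (∫ x in Ioi (0 : ℝ), ((1 + x ^ 2) ^ 1)⁻¹) = π / 2 ∧
    (∫ x in Ioi (0 : ℝ), ((1 + x ^ 2) ^ 2)⁻¹) = π / 4 ∧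
    (∫ x in Ioi (0 : ℝ), ((1 + x ^ 2) ^ 3)⁻¹) = 3 * π / 16 ∧
    (∫ x in Ioi (0 : ℝ), ((1 + x ^ 2) ^ 4)⁻¹) = 5 * π / 32 ∧
    (∫ x in Ioi (0 : ℝ), ((1 + x ^ 2) ^ 5)⁻¹) = 35 * π / 256 := by
  have h1 : (∫ x in Ioi (0 : ℝ), ((1 + x ^ 2) ^ 1)⁻¹) = π / 2 := by
    simp [integral_Ioi_inv_one_add_sq]
  have h2 := integral_Ioi_inv_one_add_sq_pow_succ one_ne_zero
  have h3 := integral_Ioi_inv_one_add_sq_pow_succ two_ne_zero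
  have h4 := integral_Ioi_inv_one_add_sq_pow_succ three_ne_zero
  have h5 := integral_Ioi_inv_one_add_sq_pow_succ four_ne_zero
  norm_num only at h2 h3 h4 h5
  rw [h1] at h2
  rw [h2] at h3
  rw [h3] at h4
  rw [h4] at h5
  refine ⟨h1, ?_, ?_, ?_, ?_⟩ <;> linarith

theorem integrableOn_inv_sq_add_sq {a : ℝ} (ha : 0 < a) :
    IntegrableOn (fun x : ℝ => (x ^ 2 + a ^ 2)⁻¹) (Ioi 0) := by
  have h := ((integrable_inv_one_add_sq.comp_mul_left' (inv_ne_zero ha.ne')).const_mul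
    (a ^ 2)⁻¹).integrableOn (s := Ioi 0)
  refine h.congr_fun (fun x _ => ?_) measurableSet_Ioi
  have : x ^ 2 + a ^ 2 ≠ 0 := by positivity
  have : a ^ 2 + x ^ 2 ≠ 0 := by positivity
  field_simp
  ring

theorem integral_Ioi_inv_sq_add_sq {a : ℝ} (ha : 0 < a) :
    (∫ x in Ioi (0 : ℝ), (x ^ 2 + a ^ 2)⁻¹) = π / (2 * a) := by
  have h := integral_comp_mul_left_Ioi (fun x : ℝ => (1 + x ^ 2)⁻¹) 0 (inv_pos.2 ha)
  rw [mul_zero, integral_Ioi_inv_one_add_sq, arctan_zero, sub_zero, inv_inv, smul_eq_mul] at h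
  have e : (∫ x in Ioi (0 : ℝ), (x ^ 2 + a ^ 2)⁻¹) =
      ∫ x in Ioi (0 : ℝ), (a ^ 2)⁻¹ * (1 + (a⁻¹ * x) ^ 2)⁻¹ := by
    refine setIntegral_congr_fun measurableSet_Ioi (fun x _ => ?_)
    have : x ^ 2 + a ^ 2 ≠ 0 := by positivity
    have : a ^ 2 + x ^ 2 ≠ 0 := by positivity
    field_simp
    ring
  rw [e, integral_const_mul, h]
  field_simp

theorem integrableOn_mul_one_sub_sq_div :
    IntegrableOn (fun x : ℝ => x * (1 - x ^ 2) / (1 + x ^ 2) ^ 4) (Ioi 0) := by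
  refine (integrable_inv_one_add_sq.integrableOn (s := Ioi 0)).mono'
    (Measurable.aestronglyMeasurable (by fun_prop)) ?_
  filter_upwards with x
  have h1 : 0 < 1 + x ^ 2 := by positivity
  rw [norm_eq_abs, abs_div, abs_of_pos (pow_pos h1 4), inv_eq_one_div,
    div_le_div_iff₀ (by positivity) h1]
  have : |x * (1 - x ^ 2)| ≤ (1 + x ^ 2) ^ 2 := by
    rw [abs_le]
    constructor <;> nlinarith [sq_nonneg (x - 1), sq_nonneg (x + 1), sq_nonneg (x ^ 2 - x),
      sq_nonneg (x ^ 2 + x), sq_nonneg x, sq_nonneg (x ^ 2)]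
  nlinarith [mul_le_mul_of_nonneg_right this h1.le, pow_le_pow_right₀ (by nlinarith : 1 ≤ 1 + x ^ 2)
    (by norm_num : 3 ≤ 4)]

theorem integral_Ioi_mul_one_sub_sq_div :
    (∫ x in Ioi (0 : ℝ), x * (1 - x ^ 2) / (1 + x ^ 2) ^ 4) = 1 / 12 := by
  have hd : ∀ x ∈ Ici (0 : ℝ), HasDerivAt
      (fun x : ℝ => 1 / 4 * ((1 + x ^ 2) ^ 2)⁻¹ - 1 / 3 * ((1 + x ^ 2) ^ 3)⁻¹)
      (x * (1 - x ^ 2) / (1 + x ^ 2) ^ 4) x := by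
    intro x _
    have h0 : 1 + x ^ 2 ≠ 0 := by positivity
    have hu : HasDerivAt (fun x : ℝ => 1 + x ^ 2) (2 * x) x := by
      simpa using (hasDerivAt_pow 2 x).const_add 1
    refine ((((hu.pow 2).inv (pow_ne_zero _ h0)).const_mul (1 / 4)).sub
      (((hu.pow 3).inv (pow_ne_zero _ h0)).const_mul (1 / 3))).congr_deriv ?_
    simp only [Pi.pow_apply]
    field_simp
    ring
  have ht : Filter.Tendsto (fun x : ℝ => 1 + x ^ 2) Filter.atTop Filter.atTop :=
    Filter.tendsto_atTop_add_const_left _ _ (Filter.tendsto_pow_atTop two_ne_zero)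
  have hp : ∀ k : ℕ, k ≠ 0 →
      Filter.Tendsto (fun x : ℝ => ((1 + x ^ 2) ^ k)⁻¹) Filter.atTop (nhds 0) := fun k hk =>
    tendsto_inv_atTop_zero.comp ((Filter.tendsto_pow_atTop hk).comp ht)
  have hl := ((hp 2 two_ne_zero).const_mul (1 / 4)).sub ((hp 3 three_ne_zero).const_mul (1 / 3))
  rw [integral_Ioi_of_hasDerivAt_of_tendsto' hd integrableOn_mul_one_sub_sq_div hl]
  norm_num

theorem integral_Ioi_one_sub_sq_div :
    (∫ x in Ioi (0 : ℝ), (1 - x ^ 2) / (1 + x ^ 2) ^ 4) = π / 8 := by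
  obtain ⟨h1, h2, h3, h4, h5⟩ := integral_Ioi_inv_one_add_sq_pow_one_to_five
  have i3 := integrableOn_inv_one_add_sq_pow three_ne_zero
  have i4 := integrableOn_inv_one_add_sq_pow four_ne_zero
  have e : EqOn (fun x : ℝ => (1 - x ^ 2) / (1 + x ^ 2) ^ 4)
      (fun x => 2 * ((1 + x ^ 2) ^ 4)⁻¹ - ((1 + x ^ 2) ^ 3)⁻¹) (Ioi 0) := by
    intro x _
    have : 1 + x ^ 2 ≠ 0 := by positivity
    field_simp
    ring
  rw [setIntegral_congr_fun measurableSet_Ioi e, integral_sub (i4.const_mul 2) i3,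
    integral_const_mul, h3, h4]
  ring

theorem integral_Ioi_sq_mul_one_sub_sq_div {a : ℝ} (ha : 0 < a) :
    (∫ x in Ioi (0 : ℝ), x ^ 2 * (1 - x ^ 2) / ((1 + x ^ 2) ^ 4 * (x ^ 2 + a ^ 2))) =
      π / (8 * (1 + a) ^ 4) := by
  obtain ⟨h1, h2, h3, h4, h5⟩ := integral_Ioi_inv_one_add_sq_pow_one_to_five
  have i1 := integrableOn_inv_one_add_sq_pow one_ne_zero
  have i2 := integrableOn_inv_one_add_sq_pow two_ne_zero
  have i3 := integrableOn_inv_one_add_sq_pow three_ne_zero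
  have i4 := integrableOn_inv_one_add_sq_pow four_ne_zero
  have i5 := integrableOn_inv_one_add_sq_pow (k := 5) (by norm_num)
  rw [IntegrableOn] at i1 i2 i3 i4 i5
  rcases eq_or_ne a 1 with rfl | ha1
  · have e : EqOn (fun x : ℝ => x ^ 2 * (1 - x ^ 2) / ((1 + x ^ 2) ^ 4 * (x ^ 2 + 1 ^ 2)))
        (fun x => 3 * ((1 + x ^ 2) ^ 4)⁻¹ - ((1 + x ^ 2) ^ 3)⁻¹ - 2 * ((1 + x ^ 2) ^ 5)⁻¹)
        (Ioi 0) := by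
      intro x _
      have : 1 + x ^ 2 ≠ 0 := by positivity
      have : x ^ 2 + 1 ≠ 0 := by positivity
      field_simp
      ring
    rw [setIntegral_congr_fun measurableSet_Ioi e, integral_sub, integral_sub,
      integral_const_mul, integral_const_mul, h3, h4, h5]
    · ring
    all_goals fun_prop
  · have hm1 : a - 1 ≠ 0 := sub_ne_zero.2 ha1
    have hp1 : a + 1 ≠ 0 := by positivity
    have hf : a ^ 2 - 1 = (a - 1) * (a + 1) := by ring
    have hm : a ^ 2 - 1 ≠ 0 := hf ▸ mul_ne_zero hm1 hp1
    have e : EqOn (fun x : ℝ => x ^ 2 * (1 - x ^ 2) / ((1 + x ^ 2) ^ 4 * (x ^ 2 + a ^ 2)))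
        (fun x => a ^ 2 * (a ^ 2 + 1) / (a ^ 2 - 1) ^ 4 *
            (((1 + x ^ 2) ^ 1)⁻¹ - (x ^ 2 + a ^ 2)⁻¹) -
          (1 / (a ^ 2 - 1) + 3 / (a ^ 2 - 1) ^ 2 + 2 / (a ^ 2 - 1) ^ 3) * ((1 + x ^ 2) ^ 2)⁻¹ +
          (3 / (a ^ 2 - 1) + 2 / (a ^ 2 - 1) ^ 2) * ((1 + x ^ 2) ^ 3)⁻¹ -
          2 / (a ^ 2 - 1) * ((1 + x ^ 2) ^ 4)⁻¹) (Ioi 0) := by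
      intro x _
      have : 1 + x ^ 2 ≠ 0 := by positivity
      have : x ^ 2 + a ^ 2 ≠ 0 := by positivity
      field_simp
      ring
    have ia := integrableOn_inv_sq_add_sq ha
    rw [IntegrableOn] at ia
    rw [setIntegral_congr_fun measurableSet_Ioi e, integral_sub, integral_add, integral_sub,
      integral_const_mul, integral_const_mul, integral_const_mul, integral_const_mul,
      integral_sub i1 ia, h1, h2, h3, h4, integral_Ioi_inv_sq_add_sq ha]
    · rw [hf, add_comm 1 a]
      field_simp
      ring
    all_goals fun_prop

theorem cosh_sub_sinh_le_one {y : ℝ} (hy : 0 ≤ y) : cosh y - sinh y ≤ 1 := by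
  rw [cosh_sub_sinh, exp_le_one_iff]
  linarith

theorem coth_sub_one_eq {y : ℝ} (hy : 0 < y) :
    cosh y / sinh y - 1 = 2 / (exp (2 * y) - 1) := by
  have hS : sinh y ≠ 0 := (sinh_pos_iff.2 hy).ne'
  have he : exp (2 * y) - 1 ≠ 0 := (sub_pos.2 (one_lt_exp_iff.2 (by linarith))).ne'
  rw [div_sub_one hS, div_eq_div_iff hS he, cosh_sub_sinh, sinh_eq, two_mul, exp_add, exp_neg]
  field_simp

theorem coth_sub_one_nonneg {y : ℝ} (hy : 0 < y) : 0 ≤ cosh y / sinh y - 1 := by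
  rw [coth_sub_one_eq hy]
  have := one_lt_exp_iff.2 (by linarith : 0 < 2 * y)
  exact div_nonneg zero_le_two (by linarith)

theorem coth_sub_one_le {y t : ℝ} (hy : 0 ≤ y) (ht : 0 < t) (h : t ≤ sinh y) :
    cosh y / sinh y - 1 ≤ 1 / t := by
  rw [div_sub_one (ht.trans_le h).ne']
  exact div_le_div₀ zero_le_one (cosh_sub_sinh_le_one hy) ht h

theorem self_le_sinh_pi_mul {x : ℝ} (hx : 0 ≤ x) : x ≤ sinh (π * x) :=
  le_trans (by nlinarith [pi_gt_three]) (self_le_sinh_iff.2 (by positivity))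

theorem sq_le_sinh_pi_mul {x : ℝ} (hx : 0 ≤ x) : x ^ 2 ≤ sinh (π * x) := by
  have h : sinh (π * x) = 2 * sinh (π * x / 2) * cosh (π * x / 2) := by
    rw [← sinh_two_mul]
    ring_nf
  have h1 : x ≤ sinh (π * x / 2) :=
    le_trans (by nlinarith [pi_gt_three]) (self_le_sinh_iff.2 (by positivity))
  have h2 := sinh_lt_cosh (π * x / 2)
  rw [h]
  nlinarith

theorem integrableOn_mul_coth_sub_one :
    IntegrableOn (fun x : ℝ => x * (1 - x ^ 2) / (1 + x ^ 2) ^ 4 *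
      (cosh (π * x) / sinh (π * x) - 1)) (Ioi 0) := by
  refine (integrable_inv_one_add_sq.integrableOn (s := Ioi 0)).mono'
    (Measurable.aestronglyMeasurable (by fun_prop)) ?_
  filter_upwards [ae_restrict_mem measurableSet_Ioi] with x hx
  rw [mem_Ioi] at hx
  have h1 : 1 ≤ 1 + x ^ 2 := by nlinarith
  have h2 := coth_sub_one_le (by positivity) hx (self_le_sinh_pi_mul hx.le)
  have h3 := coth_sub_one_nonneg (mul_pos pi_pos hx)
  calc ‖x * (1 - x ^ 2) / (1 + x ^ 2) ^ 4 * (cosh (π * x) / sinh (π * x) - 1)‖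
      = x * |1 - x ^ 2| / (1 + x ^ 2) ^ 4 * (cosh (π * x) / sinh (π * x) - 1) := by
        rw [norm_eq_abs, abs_mul, abs_of_nonneg h3, abs_div, abs_mul, abs_of_pos hx,
          abs_of_pos (by positivity : 0 < (1 + x ^ 2) ^ 4)]
    _ ≤ x * (1 + x ^ 2) / (1 + x ^ 2) ^ 4 * (1 / x) := by
        gcongr
        exact abs_le.2 ⟨by linarith, by nlinarith⟩
    _ = ((1 + x ^ 2) ^ 3)⁻¹ := by field_simp
    _ ≤ (1 + x ^ 2)⁻¹ := by
        gcongr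
        exact le_self_pow₀ h1 three_ne_zero

theorem hasSum_integral_sq_mul_one_sub_sq_div :
    HasSum (fun n : ℕ => π / (8 * (1 + ((n : ℝ) + 1)) ^ 4))
      (∫ x in Ioi (0 : ℝ), x * (1 - x ^ 2) / (1 + x ^ 2) ^ 4 / 2 *
        (π * (cosh (π * x) / sinh (π * x)) - 1 / x)) := by
  have hb : ∀ (n : ℕ) (x : ℝ),
      ‖x ^ 2 * (1 - x ^ 2) / ((1 + x ^ 2) ^ 4 * (x ^ 2 + ((n : ℝ) + 1) ^ 2))‖ ≤
        1 / ((n : ℝ) + 1) ^ 2 * (1 + x ^ 2)⁻¹ := by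
    intro n x
    have h1 : 1 ≤ 1 + x ^ 2 := by nlinarith
    have hD : 0 < (1 + x ^ 2) ^ 4 * (x ^ 2 + ((n : ℝ) + 1) ^ 2) := by positivity
    calc ‖x ^ 2 * (1 - x ^ 2) / ((1 + x ^ 2) ^ 4 * (x ^ 2 + ((n : ℝ) + 1) ^ 2))‖
        = x ^ 2 * |1 - x ^ 2| / ((1 + x ^ 2) ^ 4 * (x ^ 2 + ((n : ℝ) + 1) ^ 2)) := by
          rw [norm_eq_abs, abs_div, abs_mul, abs_of_pos hD, abs_of_nonneg (sq_nonneg x)]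
      _ ≤ (1 + x ^ 2) * (1 + x ^ 2) / ((1 + x ^ 2) ^ 4 * ((n : ℝ) + 1) ^ 2) := by
          gcongr
          · linarith
          · exact abs_le.2 ⟨by linarith, by nlinarith⟩
          · nlinarith
      _ = 1 / ((n : ℝ) + 1) ^ 2 * ((1 + x ^ 2) ^ 2)⁻¹ := by field_simp
      _ ≤ 1 / ((n : ℝ) + 1) ^ 2 * (1 + x ^ 2)⁻¹ := by
          gcongr
          exact le_self_pow₀ h1 two_ne_zero
  have hi : ∀ n : ℕ, Integrable (fun x : ℝ =>
      x ^ 2 * (1 - x ^ 2) / ((1 + x ^ 2) ^ 4 * (x ^ 2 + ((n : ℝ) + 1) ^ 2)))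
      (volume.restrict (Ioi 0)) := fun n =>
    ((integrable_inv_one_add_sq.integrableOn (s := Ioi 0)).const_mul _).mono'
      (Measurable.aestronglyMeasurable (by fun_prop)) (Filter.Eventually.of_forall (hb n))
  have hs : Summable fun n : ℕ => ∫ x in Ioi (0 : ℝ),
      ‖x ^ 2 * (1 - x ^ 2) / ((1 + x ^ 2) ^ 4 * (x ^ 2 + ((n : ℝ) + 1) ^ 2))‖ := by
    have hq : Summable fun n : ℕ => 1 / ((n : ℝ) + 1) ^ 2 := by
      simpa using (summable_nat_add_iff 1).2 (summable_one_div_nat_pow.2 one_lt_two)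
    refine Summable.of_nonneg_of_le (fun n => integral_nonneg fun x => norm_nonneg _)
      (fun n => ?_) (hq.mul_right (∫ x in Ioi (0 : ℝ), (1 + x ^ 2)⁻¹))
    rw [← integral_const_mul]
    exact integral_mono (hi n).norm
      ((integrable_inv_one_add_sq.integrableOn (s := Ioi 0)).const_mul _) (hb n)
  have h := hasSum_integral_of_summable_integral_norm hi hs
  convert! h using 1
  · funext n
    exact (integral_Ioi_sq_mul_one_sub_sq_div (by positivity)).symm
  · refine setIntegral_congr_fun measurableSet_Ioi fun x hx => ?_
    refine (((hasSum_pi_mul_coth_sub_inv hx).mul_left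
      (x * (1 - x ^ 2) / (1 + x ^ 2) ^ 4 / 2)).tsum_eq.symm).trans ?_
    refine tsum_congr fun n => ?_
    field_simp

theorem integral_Ioi_mul_coth_sub_one :
    (∫ x in Ioi (0 : ℝ), x * (1 - x ^ 2) / (1 + x ^ 2) ^ 4 *
      (cosh (π * x) / sinh (π * x) - 1)) = (π ^ 4 / 90 - 5 / 6) / 4 := by
  have hz := (((hasSum_nat_add_iff' 2).2 hasSum_zeta_four).mul_left (π / 8)).unique
    (hasSum_integral_sq_mul_one_sub_sq_div.congr_fun ?_)
  · have i1 := integrableOn_mul_coth_sub_one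
    have i2 := integrableOn_mul_one_sub_sq_div
    have i3 : IntegrableOn (fun x : ℝ => (1 - x ^ 2) / (1 + x ^ 2) ^ 4) (Ioi 0) :=
      Integrable.of_integral_ne_zero (by rw [integral_Ioi_one_sub_sq_div]; positivity)
    have e : EqOn (fun x : ℝ => x * (1 - x ^ 2) / (1 + x ^ 2) ^ 4 / 2 *
          (π * (cosh (π * x) / sinh (π * x)) - 1 / x))
        (fun x => π / 2 * (x * (1 - x ^ 2) / (1 + x ^ 2) ^ 4 *
            (cosh (π * x) / sinh (π * x) - 1)) +
          π / 2 * (x * (1 - x ^ 2) / (1 + x ^ 2) ^ 4) -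
          1 / 2 * ((1 - x ^ 2) / (1 + x ^ 2) ^ 4)) (Ioi 0) := by
      intro x hx
      have hx0 : x ≠ 0 := (mem_Ioi.1 hx).ne'
      have hS : sinh (π * x) ≠ 0 := (sinh_pos_iff.2 (mul_pos pi_pos hx)).ne'
      field_simp
      ring
    rw [IntegrableOn] at i1 i2 i3
    rw [setIntegral_congr_fun measurableSet_Ioi e, integral_sub, integral_add,
      integral_const_mul, integral_const_mul, integral_const_mul,
      integral_Ioi_mul_one_sub_sq_div, integral_Ioi_one_sub_sq_div] at hz
    · norm_num [Finset.sum_range_succ] at hz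
      have hp := pi_pos.ne'
      refine mul_left_cancel₀ hp ?_
      linarith
    all_goals fun_prop
  · intro n
    push_cast
    field_simp
    ring

theorem integrableOn_pow_four_mul_div_sinh_pow_four :
    IntegrableOn (fun x : ℝ => x ^ 4 * (2 + cosh (2 * π * x)) /
      ((1 + x ^ 2) * sinh (π * x) ^ 4)) (Ioi 0) := by
  refine ((integrable_inv_one_add_sq.integrableOn (s := Ioi 0)).const_mul 5).mono'
    (Measurable.aestronglyMeasurable (by fun_prop)) ?_
  filter_upwards [ae_restrict_mem measurableSet_Ioi] with x hx
  rw [mem_Ioi] at hx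
  have h1 := self_le_sinh_pi_mul hx.le
  have h2 := sq_le_sinh_pi_mul hx.le
  have hS : 0 < sinh (π * x) := hx.trans_le h1
  have hC : cosh (2 * π * x) = 2 * sinh (π * x) ^ 2 + 1 := by
    rw [mul_assoc, cosh_two_mul, cosh_sq]
    ring
  rw [hC, norm_of_nonneg (by positivity), ← div_eq_mul_inv,
    div_le_div_iff₀ (by positivity) (by positivity)]
  have h3 : x ^ 4 ≤ sinh (π * x) ^ 4 := by gcongr
  have h4 : x ^ 4 * sinh (π * x) ^ 2 ≤ sinh (π * x) ^ 4 := by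
    calc x ^ 4 * sinh (π * x) ^ 2 = (x ^ 2) ^ 2 * sinh (π * x) ^ 2 := by ring
      _ ≤ sinh (π * x) ^ 2 * sinh (π * x) ^ 2 := by gcongr
      _ = sinh (π * x) ^ 4 := by ring
  nlinarith [sq_nonneg x]

/-- The boundary term of the threefold integration by parts of
`x ^ 4 / (1 + x ^ 2)` against the third derivative of `coth (π * x) - 1`. -/
noncomputable def cothBoundaryTerm (x : ℝ) : ℝ :=
  x ^ 4 / (1 + x ^ 2) * (2 * π ^ 2 * (cosh (π * x) / sinh (π * x) ^ 3)) +
    2 * x ^ 3 * (2 + x ^ 2) / (1 + x ^ 2) ^ 2 * (π / sinh (π * x) ^ 2) +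
    (2 * x ^ 6 + 6 * x ^ 4 + 12 * x ^ 2) / (1 + x ^ 2) ^ 3 *
      (cosh (π * x) / sinh (π * x) - 1)

theorem hasDerivAt_cothBoundaryTerm {x : ℝ} (hx : 0 < x) :
    HasDerivAt cothBoundaryTerm
      (24 * (x * (1 - x ^ 2) / (1 + x ^ 2) ^ 4 * (cosh (π * x) / sinh (π * x) - 1)) -
        2 * π ^ 3 * (x ^ 4 * (2 + cosh (2 * π * x)) / ((1 + x ^ 2) * sinh (π * x) ^ 4))) x := by
  have hS : sinh (π * x) ≠ 0 := (sinh_pos_iff.2 (by positivity)).ne'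
  have h0 : 1 + x ^ 2 ≠ 0 := by positivity
  have hu : HasDerivAt (fun x : ℝ => 1 + x ^ 2) (2 * x) x := by
    simpa using (hasDerivAt_pow 2 x).const_add 1
  have hl : HasDerivAt (fun x : ℝ => π * x) π x := by simpa using (hasDerivAt_id x).const_mul π
  have hs := hl.sinh
  have hc := hl.cosh
  have hC : cosh (2 * π * x) = 2 * sinh (π * x) ^ 2 + 1 := by
    rw [mul_assoc, cosh_two_mul, cosh_sq]
    ring
  have d0 : HasDerivAt (fun x : ℝ => x ^ 4 / (1 + x ^ 2))
      (2 * x ^ 3 * (2 + x ^ 2) / (1 + x ^ 2) ^ 2) x := by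
    refine ((hasDerivAt_pow 4 x).div hu h0).congr_deriv ?_
    field_simp
    ring
  have d1 : HasDerivAt (fun x : ℝ => 2 * x ^ 3 * (2 + x ^ 2) / (1 + x ^ 2) ^ 2)
      ((2 * x ^ 6 + 6 * x ^ 4 + 12 * x ^ 2) / (1 + x ^ 2) ^ 3) x := by
    refine ((((hasDerivAt_pow 3 x).const_mul 2).mul ((hasDerivAt_pow 2 x).const_add 2)).div
      (hu.pow 2) (pow_ne_zero _ h0)).congr_deriv ?_
    simp only [Pi.pow_apply, Pi.mul_apply]
    field_simp
    ring
  have d2 : HasDerivAt (fun x : ℝ => (2 * x ^ 6 + 6 * x ^ 4 + 12 * x ^ 2) / (1 + x ^ 2) ^ 3)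
      (24 * (x * (1 - x ^ 2)) / (1 + x ^ 2) ^ 4) x := by
    refine (((((hasDerivAt_pow 6 x).const_mul 2).add ((hasDerivAt_pow 4 x).const_mul 6)).add
      ((hasDerivAt_pow 2 x).const_mul 12)).div (hu.pow 3) (pow_ne_zero _ h0)).congr_deriv ?_
    simp only [Pi.pow_apply, Pi.add_apply]
    field_simp
    ring
  have c0 : HasDerivAt (fun x : ℝ => cosh (π * x) / sinh (π * x) - 1)
      (-(π / sinh (π * x) ^ 2)) x := by
    refine ((hc.div hs hS).sub_const 1).congr_deriv ?_
    field_simp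
    rw [cosh_sq]
    ring
  have c1 : HasDerivAt (fun x : ℝ => π / sinh (π * x) ^ 2)
      (-(2 * π ^ 2 * (cosh (π * x) / sinh (π * x) ^ 3))) x := by
    refine ((hasDerivAt_const x π).div (hs.pow 2) (pow_ne_zero _ hS)).congr_deriv ?_
    simp only [Pi.pow_apply]
    field_simp
    ring
  have c2 : HasDerivAt (fun x : ℝ => 2 * π ^ 2 * (cosh (π * x) / sinh (π * x) ^ 3))
      (-(2 * π ^ 3 * ((2 + cosh (2 * π * x)) / sinh (π * x) ^ 4))) x := by
    refine ((hc.div (hs.pow 3) (pow_ne_zero _ hS)).const_mul (2 * π ^ 2)).congr_deriv ?_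
    simp only [Pi.pow_apply]
    rw [hC]
    field_simp
    rw [cosh_sq]
    ring
  refine (((d0.mul c2).add (d1.mul c1)).add (d2.mul c0)).congr_deriv ?_
  field_simp
  ring

theorem cothBoundaryTerm_nonneg {x : ℝ} (hx : 0 < x) : 0 ≤ cothBoundaryTerm x := by
  have hS : 0 < sinh (π * x) := sinh_pos_iff.2 (by positivity)
  have h3 := coth_sub_one_nonneg (mul_pos pi_pos hx)
  have hC := cosh_pos (π * x)
  unfold cothBoundaryTerm
  positivity

theorem cothBoundaryTerm_le {x t p q r : ℝ} (hx : 0 < x) (ht : 0 < t) (h : t ≤ sinh (π * x))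
    (hp : x ^ 4 / (1 + x ^ 2) ≤ p) (hq : 2 * x ^ 3 * (2 + x ^ 2) / (1 + x ^ 2) ^ 2 ≤ q)
    (hr : (2 * x ^ 6 + 6 * x ^ 4 + 12 * x ^ 2) / (1 + x ^ 2) ^ 3 ≤ r) :
    cothBoundaryTerm x ≤
      p * (2 * π ^ 2 * (1 / t ^ 3 + 1 / t ^ 2)) + q * (π / t ^ 2) + r * (1 / t) := by
  have hS : 0 < sinh (π * x) := ht.trans_le h
  have hC := cosh_pos (π * x)
  have h1 := coth_sub_one_le (by positivity) ht h
  have h3 := coth_sub_one_nonneg (mul_pos pi_pos hx)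
  have hp0 : 0 ≤ p := le_trans (by positivity) hp
  have hq0 : 0 ≤ q := le_trans (by positivity) hq
  have hr0 : 0 ≤ r := le_trans (by positivity) hr
  have h4 : cosh (π * x) / sinh (π * x) ^ 3 ≤ 1 / t ^ 3 + 1 / t ^ 2 := by
    calc cosh (π * x) / sinh (π * x) ^ 3 ≤ (1 + sinh (π * x)) / sinh (π * x) ^ 3 := by
          gcongr
          linarith [cosh_sub_sinh_le_one (by positivity : 0 ≤ π * x)]
      _ = 1 / sinh (π * x) ^ 3 + 1 / sinh (π * x) ^ 2 := by field_simp
      _ ≤ 1 / t ^ 3 + 1 / t ^ 2 := by gcongr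
  unfold cothBoundaryTerm
  gcongr

theorem continuousWithinAt_cothBoundaryTerm :
    ContinuousWithinAt cothBoundaryTerm (Ici 0) 0 := by
  have h0 : cothBoundaryTerm 0 = 0 := by simp [cothBoundaryTerm]
  rw [ContinuousWithinAt, h0]
  have hlim : Filter.Tendsto (fun x : ℝ => 2 * π ^ 2 * (x + x ^ 2) + 4 * π * x + 12 * x)
      (nhdsWithin 0 (Ici 0)) (nhds 0) := by
    have : Continuous (fun x : ℝ => 2 * π ^ 2 * (x + x ^ 2) + 4 * π * x + 12 * x) := by fun_prop
    simpa using this.continuousWithinAt.tendsto (s := Ici 0) (x := 0)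
  refine tendsto_of_tendsto_of_tendsto_of_le_of_le' tendsto_const_nhds hlim ?_ ?_
  · filter_upwards [self_mem_nhdsWithin] with x hx
    rcases (mem_Ici.1 hx).eq_or_lt with rfl | hx
    · exact h0.ge
    · exact cothBoundaryTerm_nonneg hx
  · filter_upwards [self_mem_nhdsWithin] with x hx
    rcases (mem_Ici.1 hx).eq_or_lt with rfl | hx
    · simp [h0]
    · refine (cothBoundaryTerm_le (p := x ^ 4) (q := 4 * x ^ 3) (r := 12 * x ^ 2) hx hx
        (self_le_sinh_pi_mul hx.le) ?_ ?_ ?_).trans_eq ?_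
      · exact div_le_self (by positivity) (by nlinarith)
      · rw [div_le_iff₀ (by positivity), ← sub_nonneg]
        ring_nf
        positivity
      · rw [div_le_iff₀ (by positivity), ← sub_nonneg]
        ring_nf
        positivity
      · field_simp

theorem tendsto_cothBoundaryTerm_atTop :
    Filter.Tendsto cothBoundaryTerm Filter.atTop (nhds 0) := by
  have hlim : Filter.Tendsto (fun x : ℝ => 2 * π ^ 2 * (x⁻¹ ^ 4 + x⁻¹ ^ 2) +
      2 * π * x⁻¹ ^ 3 + 12 * x⁻¹ ^ 2) Filter.atTop (nhds 0) := by
    have : Continuous (fun x : ℝ => 2 * π ^ 2 * (x ^ 4 + x ^ 2) + 2 * π * x ^ 3 + 12 * x ^ 2) := by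
      fun_prop
    exact (this.tendsto' 0 0 (by simp)).comp tendsto_inv_atTop_zero
  refine tendsto_of_tendsto_of_tendsto_of_le_of_le' tendsto_const_nhds hlim ?_ ?_
  · filter_upwards [Filter.eventually_gt_atTop 0] with x hx using cothBoundaryTerm_nonneg hx
  · filter_upwards [Filter.eventually_gt_atTop 0] with x hx
    refine (cothBoundaryTerm_le (p := x ^ 2) (q := 2 * x) (r := 12) hx (pow_pos hx 2)
      (sq_le_sinh_pi_mul hx.le) ?_ ?_ ?_).trans_eq ?_
    · rw [div_le_iff₀ (by positivity)]
      nlinarith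
    · rw [div_le_iff₀ (by positivity), ← sub_nonneg]
      ring_nf
      positivity
    · rw [div_le_iff₀ (by positivity), ← sub_nonneg]
      ring_nf
      positivity
    · field_simp

theorem pi_pow_three_mul_integral_eq :
    π ^ 3 * (∫ x in Ioi (0 : ℝ),
        x ^ 4 * (2 + cosh (2 * π * x)) / ((1 + x ^ 2) * sinh (π * x) ^ 4)) =
      12 * ∫ x in Ioi (0 : ℝ), x * (1 - x ^ 2) / (1 + x ^ 2) ^ 4 *
        (cosh (π * x) / sinh (π * x) - 1) := by
  have i1 := integrableOn_mul_coth_sub_one.const_mul 24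
  have i2 := integrableOn_pow_four_mul_div_sinh_pow_four.const_mul (2 * π ^ 3)
  have h := integral_Ioi_of_hasDerivAt_of_tendsto continuousWithinAt_cothBoundaryTerm
    (fun x hx => hasDerivAt_cothBoundaryTerm hx) (i1.sub i2) tendsto_cothBoundaryTerm_atTop
  have h0 : cothBoundaryTerm 0 = 0 := by simp [cothBoundaryTerm]
  rw [integral_sub i1 i2, integral_const_mul, integral_const_mul, h0] at h
  linarith

theorem integral_Ioi_mul_sq_sub_one_div_exp_sub_one :
    (∫ x in Ioi (0 : ℝ), x * (x ^ 2 - 1) / ((exp (2 * π * x) - 1) * (1 + x ^ 2) ^ 4)) =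
      -1 / 2 * ∫ x in Ioi (0 : ℝ), x * (1 - x ^ 2) / (1 + x ^ 2) ^ 4 *
        (cosh (π * x) / sinh (π * x) - 1) := by
  rw [← integral_const_mul]
  refine setIntegral_congr_fun measurableSet_Ioi fun x hx => ?_
  have hy : 0 < π * x := mul_pos pi_pos hx
  have he : exp (2 * (π * x)) - 1 ≠ 0 :=
    (sub_pos.2 (one_lt_exp_iff.2 (by linarith))).ne'
  simp only [coth_sub_one_eq hy, mul_assoc 2 π x]
  field_simp
  ring

theorem zeta_four_eq_integral :
    riemannZeta 4 =
      ((5 / 6 + π ^ 3 / 3 * ∫ x in Ioi (0 : ℝ),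
        x ^ 4 * (2 + Real.cosh (2 * π * x)) / ((1 + x ^ 2) * Real.sinh (π * x) ^ 4) : ℝ) : ℂ) ∧
    riemannZeta 4 =
      ((5 / 6 - 8 * ∫ x in Ioi (0 : ℝ),
        x * (x ^ 2 - 1) / ((Real.exp (2 * π * x) - 1) * (1 + x ^ 2) ^ 4) : ℝ) : ℂ) := by
  have hz : riemannZeta 4 = ((π ^ 4 / 90 : ℝ) : ℂ) := by
    rw [riemannZeta_four]
    push_cast
    rfl
  have h1 := pi_pow_three_mul_integral_eq
  have h2 := integral_Ioi_mul_sq_sub_one_div_exp_sub_one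
  rw [integral_Ioi_mul_coth_sub_one] at h1 h2
  rw [hz, Complex.ofReal_inj, Complex.ofReal_inj]
  constructor <;> linarith
end

section
/- For every real number t ≥ 0 and every complex number s with −1 < Re(s) < 1 and s ≠ 0, one has ∫₀^t x^s (t−x)^{−s} / (1+x²) dx = Γ(s) Γ(1−s) (1+t²)^{−s/2} sin(s · arctan t). -/
open Real Complex MeasureTheory

/-- The Beta weight `u ^ s * (1 - u) ^ (-s)` is integrable on `[0, 1]` when `-1 < re s < 1`. -/
lemma intervalIntegrable_cpow_mul_one_sub_cpow_neg {s : ℂ} (hs1 : -1 < s.re) (hs2 : s.re < 1) :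
    IntervalIntegrable (fun u : ℝ => (u : ℂ) ^ s * (1 - (u : ℂ)) ^ (-s)) volume 0 1 := by
  have h := Complex.betaIntegral_convergent (u := 1 + s) (v := 1 - s)
    (by simp; linarith) (by simp; linarith)
  simpa using h

lemma integral_cpow_mul_one_sub_cpow_neg {s : ℂ} (hs1 : -1 < s.re) (hs2 : s.re < 1)
    (hs0 : s ≠ 0) :
    ∫ u in (0 : ℝ)..1, (u : ℂ) ^ s * (1 - (u : ℂ)) ^ (-s) =
      s * (Complex.Gamma s * Complex.Gamma (1 - s)) := by
  have h := Complex.Gamma_mul_Gamma_eq_betaIntegral (s := s + 1) (t := 1 - s)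
    (by simp; linarith) (by simp; linarith)
  have h2 : s + 1 + (1 - s) = 2 := by ring
  rw [h2, Complex.Gamma_ofNat_eq_factorial, Complex.Gamma_add_one s hs0] at h
  simp only [Complex.betaIntegral, add_sub_cancel_right, sub_sub_cancel_left] at h
  simp at h
  rw [← h, mul_assoc]

lemma one_le_norm_one_sub_mul_ofReal {z : ℂ} (hz : z.re = 0) (r : ℝ) : 1 ≤ ‖1 - z * r‖ := by
  calc (1 : ℝ) = |(1 - z * r).re| := by simp [hz]
    _ ≤ ‖1 - z * r‖ := Complex.abs_re_le_norm _

lemma one_sub_mul_ofReal_mem_slitPlane {z : ℂ} (hz : z.re = 0) (r : ℝ) :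
    1 - z * r ∈ Complex.slitPlane := by
  left; simp [hz]

lemma one_sub_mul_ofReal_ne_zero {z : ℂ} (hz : z.re = 0) (r : ℝ) : 1 - z * r ≠ 0 :=
  Complex.slitPlane_ne_zero (one_sub_mul_ofReal_mem_slitPlane hz r)

lemma one_sub_mul_ofReal_mul_ofReal_ne_zero {z : ℂ} (hz : z.re = 0) (r u : ℝ) :
    1 - z * r * u ≠ 0 := by
  simpa [mul_assoc] using one_sub_mul_ofReal_ne_zero hz (r * u)

lemma continuous_inv_one_sub_mul_ofReal {z : ℂ} (hz : z.re = 0) (r : ℝ) :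
    Continuous fun u : ℝ => (1 - z * r * u)⁻¹ :=
  Continuous.inv₀ (by fun_prop) (one_sub_mul_ofReal_mul_ofReal_ne_zero hz r)

lemma norm_inv_one_sub_mul_ofReal_le_one {z : ℂ} (hz : z.re = 0) (r u : ℝ) :
    ‖(1 - z * r * u)⁻¹‖ ≤ 1 := by
  rw [norm_inv]
  apply inv_le_one_of_one_le₀
  simpa [mul_assoc] using one_le_norm_one_sub_mul_ofReal hz (r * u)

/-- Integration by parts: the integrand is, up to the factor `-w` with `w = z * r`, the derivative
of `u ^ (1 + s) * (1 - u) ^ (1 - s) / (1 - w * u)`, which vanishes at both endpoints. -/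
lemma integral_beta_weight_mul_eq_zero {s z : ℂ} (hs1 : -1 < s.re) (hs2 : s.re < 1)
    (hz : z.re = 0) (r : ℝ) :
    ∫ u in (0 : ℝ)..1, (u : ℂ) ^ s * (1 - (u : ℂ)) ^ (-s) *
      ((1 - z * r) * ((1 - z * r * u)⁻¹) ^ 2 - s * (z * r) * (1 - z * r * u)⁻¹ - 1) = 0 := by
  have hc := continuous_inv_one_sub_mul_ofReal hz r
  have hp : s + 1 ≠ 0 := fun h => by
    have := congrArg Complex.re h
    simp at this; linarith
  have hm : 1 - s ≠ 0 := fun h => by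
    have := congrArg Complex.re h
    simp at this; linarith
  have key := intervalIntegral.integral_eq_sub_of_hasDerivAt_of_le (a := 0) (b := 1)
    (f := fun u : ℝ => -(z * r) * ((u : ℂ) ^ (s + 1) * (1 - (u : ℂ)) ^ (1 - s)) *
      (1 - z * r * u)⁻¹)
    (f' := fun u : ℝ => (u : ℂ) ^ s * (1 - (u : ℂ)) ^ (-s) *
      ((1 - z * r) * ((1 - z * r * u)⁻¹) ^ 2 - s * (z * r) * (1 - z * r * u)⁻¹ - 1))
    zero_le_one ?_ ?_ ?_
  · rw [key]
    simp [Complex.zero_cpow hp, Complex.zero_cpow hm]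
  · apply Continuous.continuousOn
    refine (continuous_const.mul (Continuous.mul ?_ ?_)).mul hc
    · exact Complex.continuous_ofReal_cpow_const (by simp; linarith)
    · have := (Complex.continuous_ofReal_cpow_const (y := 1 - s) (by simp; linarith)).comp
        (continuous_const.sub continuous_id : Continuous fun u : ℝ => 1 - u)
      simpa [Function.comp_def] using this
  · intro u hu
    have hu0 : (u : ℂ) ≠ 0 := by exact_mod_cast hu.1.ne'
    have hu1 : (1 - (u : ℂ)) ≠ 0 := by
      have : (1 - u : ℝ) ≠ 0 := by linarith [hu.2]
      exact_mod_cast this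
    have hq := one_sub_mul_ofReal_mul_ofReal_ne_zero hz r u
    have hid : HasDerivAt (fun x : ℝ => (x : ℂ)) 1 u := Complex.ofRealCLM.hasDerivAt
    have d1 : HasDerivAt (fun x : ℝ => (x : ℂ) ^ (s + 1)) ((s + 1) * (u : ℂ) ^ s * 1) u := by
      have := ((hasDerivAt_id (u : ℂ)).cpow_const (c := s + 1)
        (Or.inl (by simpa using hu.1))).comp_ofReal
      simpa using this
    have d2 : HasDerivAt (fun x : ℝ => (1 - (x : ℂ)) ^ (1 - s))
        ((1 - s) * (1 - (u : ℂ)) ^ (-s) * (-1)) u := by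
      have := (((hasDerivAt_id (u : ℂ)).const_sub 1).cpow_const (c := 1 - s)
        (Or.inl (by simpa using hu.2))).comp_ofReal
      simpa using this
    have d3 := ((hid.const_mul (z * r)).const_sub 1).inv hq
    have d := ((d1.mul d2).const_mul (-(z * r))).mul d3
    refine d.congr_deriv ?_
    simp only [Pi.mul_apply, Pi.inv_apply]
    rw [Complex.cpow_add _ _ hu0, sub_eq_add_neg 1 s, Complex.cpow_add _ _ hu1,
      Complex.cpow_one, Complex.cpow_one]
    field_simp
    ring
  · exact (intervalIntegrable_cpow_mul_one_sub_cpow_neg hs1 hs2).mul_continuousOn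
      (Continuous.continuousOn (by fun_prop))

lemma hasDerivAt_integral_beta_weight {s z : ℂ} (hs1 : -1 < s.re) (hs2 : s.re < 1)
    (hz : z.re = 0) (r : ℝ) :
    HasDerivAt (fun r : ℝ => ∫ u in (0 : ℝ)..1, (u : ℂ) ^ s * (1 - (u : ℂ)) ^ (-s) *
        (z * r * (1 - z * r * u)⁻¹))
      (∫ u in (0 : ℝ)..1, (u : ℂ) ^ s * (1 - (u : ℂ)) ^ (-s) *
        (z * ((1 - z * r * u)⁻¹) ^ 2)) r := by
  have hf := intervalIntegrable_cpow_mul_one_sub_cpow_neg hs1 hs2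
  have hc := continuous_inv_one_sub_mul_ofReal hz
  refine (intervalIntegral.hasDerivAt_integral_of_dominated_loc_of_deriv_le
    (s := Set.univ) (μ := volume) (a := 0) (b := 1)
    (F := fun (r u : ℝ) => (u : ℂ) ^ s * (1 - (u : ℂ)) ^ (-s) * (z * r * (1 - z * r * u)⁻¹))
    (F' := fun (r u : ℝ) => (u : ℂ) ^ s * (1 - (u : ℂ)) ^ (-s) *
      (z * ((1 - z * r * u)⁻¹) ^ 2))
    (bound := fun u : ℝ => ‖(u : ℂ) ^ s * (1 - (u : ℂ)) ^ (-s)‖ * ‖z‖)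
    Filter.univ_mem ?_ ?_ ?_ ?_ ?_ ?_).2
  · refine Filter.Eventually.of_forall fun x => ?_
    have := hc x
    exact (hf.mul_continuousOn (Continuous.continuousOn (by fun_prop))).def'.aestronglyMeasurable
  · have := hc r
    exact hf.mul_continuousOn (Continuous.continuousOn (by fun_prop))
  · have := hc r
    exact (hf.mul_continuousOn (Continuous.continuousOn (by fun_prop))).def'.aestronglyMeasurable
  · refine Filter.Eventually.of_forall fun u _ x _ => ?_
    rw [norm_mul, norm_mul z, norm_pow]
    have := norm_inv_one_sub_mul_ofReal_le_one hz x u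
    gcongr
    exact mul_le_of_le_one_right (norm_nonneg _) (pow_le_one₀ (norm_nonneg _) this)
  · exact hf.norm.mul_const _
  · refine Filter.Eventually.of_forall fun u _ x _ => ?_
    have hq := one_sub_mul_ofReal_mul_ofReal_ne_zero hz x u
    have hid : HasDerivAt (fun x : ℝ => (x : ℂ)) 1 x := Complex.ofRealCLM.hasDerivAt
    have hd := hid.const_mul z
    have d := (hd.mul (((hd.mul_const (u : ℂ)).const_sub 1).inv hq)).const_mul
      ((u : ℂ) ^ s * (1 - (u : ℂ)) ^ (-s))
    refine d.congr_deriv ?_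
    simp only [Pi.inv_apply]
    field_simp
    ring

/-- Euler's integral for `₂F₁(1, 1 + s; 2; w)` at a purely imaginary `w = z * r`. -/
lemma integral_beta_weight_mul_inv_one_sub {s z : ℂ} (hs1 : -1 < s.re) (hs2 : s.re < 1)
    (hs0 : s ≠ 0) (hz : z.re = 0) (r : ℝ) :
    ∫ u in (0 : ℝ)..1, (u : ℂ) ^ s * (1 - (u : ℂ)) ^ (-s) * (z * r * (1 - z * r * u)⁻¹) =
      Complex.Gamma s * Complex.Gamma (1 - s) * ((1 - z * r) ^ (-s) - 1) := by
  set c := Complex.Gamma s * Complex.Gamma (1 - s) with hcdef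
  set M : ℝ → ℂ := fun r => ∫ u in (0 : ℝ)..1, (u : ℂ) ^ s * (1 - (u : ℂ)) ^ (-s) *
    (z * r * (1 - z * r * u)⁻¹) with hM
  have hf := intervalIntegrable_cpow_mul_one_sub_cpow_neg hs1 hs2
  have hode (x : ℝ) : (1 - z * x) * ∫ u in (0 : ℝ)..1, (u : ℂ) ^ s * (1 - (u : ℂ)) ^ (-s) *
      (z * ((1 - z * x * u)⁻¹) ^ 2) = s * z * (M x + c) := by
    have hc := continuous_inv_one_sub_mul_ofReal hz x
    have h0 := integral_beta_weight_mul_eq_zero hs1 hs2 hz x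
    have hB := integral_cpow_mul_one_sub_cpow_neg hs1 hs2 hs0
    rw [← hcdef] at hB
    rw [mul_add, show s * z * c = z * (s * c) by ring, ← hB, hM]
    dsimp only
    rw [← intervalIntegral.integral_const_mul, ← intervalIntegral.integral_const_mul,
      ← intervalIntegral.integral_const_mul, ← intervalIntegral.integral_add, ← sub_eq_zero,
      ← intervalIntegral.integral_sub, ← mul_zero z, ← h0, ← intervalIntegral.integral_const_mul]
    · congr 1
      ext u
      ring
    · exact (hf.mul_continuousOn (Continuous.continuousOn (by fun_prop))).const_mul _
    · exact ((hf.mul_continuousOn (Continuous.continuousOn (by fun_prop))).const_mul _).add (hf.const_mul _)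
    · exact (hf.mul_continuousOn (Continuous.continuousOn (by fun_prop))).const_mul _
    · exact hf.const_mul _
  have hder (x : ℝ) : HasDerivAt (fun x : ℝ => (1 - z * x) ^ s * (M x + c)) 0 x := by
    have hne := one_sub_mul_ofReal_ne_zero hz x
    have d1 := ((((hasDerivAt_id (x : ℂ)).const_mul z).const_sub 1).cpow_const (c := s)
      (one_sub_mul_ofReal_mem_slitPlane hz x)).comp_ofReal
    have hM' : HasDerivAt M _ x := hasDerivAt_integral_beta_weight hs1 hs2 hz x
    have h := hode x
    generalize (∫ u in (0 : ℝ)..1, (u : ℂ) ^ s * (1 - (u : ℂ)) ^ (-s) *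
      (z * ((1 - z * x * u)⁻¹) ^ 2)) = D at h hM'
    have d := d1.mul (hM'.add_const c)
    refine d.congr_deriv ?_
    simp only [id_eq]
    rw [Complex.cpow_sub _ _ hne, Complex.cpow_one]
    field_simp
    linear_combination (1 - z * x) ^ s * h
  have hconst := is_const_of_deriv_eq_zero (fun x => (hder x).differentiableAt)
    (fun x => (hder x).deriv) r 0
  have hM0 : M 0 = 0 := by simp [hM]
  simp only [hM0, Complex.ofReal_zero, mul_zero, sub_zero, Complex.one_cpow, one_mul,
    zero_add] at hconst
  have hne : (1 - z * r) ^ s ≠ 0 := by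
    simp [Complex.cpow_eq_zero_iff, one_sub_mul_ofReal_ne_zero hz r]
  change M r = _
  rw [Complex.cpow_neg]
  field_simp
  linear_combination hconst

lemma log_one_add_ofReal_mul_I (t : ℝ) :
    Complex.log (1 + t * I) = Real.log (1 + t ^ 2) / 2 + Real.arctan t * I := by
  have hn : ‖1 + t * I‖ = √(1 + t ^ 2) := by
    simpa using Complex.norm_add_mul_I 1 t
  apply Complex.ext
  · rw [Complex.log_re, hn, Real.log_sqrt (by positivity)]
    simp
    norm_cast
  · rw [Complex.log_im, Complex.arg_of_re_nonneg (by simp), hn, Real.arctan_eq_arcsin]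
    simp

theorem integral_cpow_mul_cpow_div (t : ℝ) (ht : 0 ≤ t)
    (s : ℂ) (hs1 : -1 < s.re) (hs2 : s.re < 1) (hs0 : s ≠ 0) :
    ∫ x in (0 : ℝ)..t, ((x : ℝ) : ℂ) ^ s * ((t - x : ℝ) : ℂ) ^ (-s) / (1 + ((x : ℝ) : ℂ) ^ 2) =
      Complex.Gamma s * Complex.Gamma (1 - s) * ((1 + t ^ 2 : ℝ) : ℂ) ^ (-s / 2) *
        Complex.sin (s * Real.arctan t) := by
  rcases ht.eq_or_lt with rfl | htpos
  · simp
  have ht0 : (t : ℂ) ≠ 0 := by exact_mod_cast htpos.ne'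
  have hf := intervalIntegrable_cpow_mul_one_sub_cpow_neg hs1 hs2
  have hp := integral_beta_weight_mul_inv_one_sub hs1 hs2 hs0 Complex.I_re t
  have hm := integral_beta_weight_mul_inv_one_sub (z := -I) hs1 hs2 hs0 (by simp) t
  have hcp := continuous_inv_one_sub_mul_ofReal Complex.I_re t
  have hcm := continuous_inv_one_sub_mul_ofReal (z := -I) (by simp) t
  have hsub := intervalIntegral.smul_integral_comp_mul_left (a := 0) (b := 1)
    (fun x : ℝ => (x : ℂ) ^ s * ((t - x : ℝ) : ℂ) ^ (-s) / (1 + (x : ℂ) ^ 2)) t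
  rw [mul_zero, mul_one] at hsub
  rw [← hsub, Complex.real_smul, ← intervalIntegral.integral_const_mul]
  have hsplit : ∫ u in (0 : ℝ)..1, (t : ℂ) * (((t * u : ℝ) : ℂ) ^ s *
      ((t - t * u : ℝ) : ℂ) ^ (-s) / (1 + ((t * u : ℝ) : ℂ) ^ 2)) =
      (1 / (2 * I)) * ((∫ u in (0 : ℝ)..1, (u : ℂ) ^ s * (1 - (u : ℂ)) ^ (-s) *
        (I * t * (1 - I * t * u)⁻¹)) - ∫ u in (0 : ℝ)..1, (u : ℂ) ^ s * (1 - (u : ℂ)) ^ (-s) *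
        (-I * t * (1 - -I * t * u)⁻¹)) := by
    rw [← intervalIntegral.integral_sub (hf.mul_continuousOn (Continuous.continuousOn (by fun_prop)))
      (hf.mul_continuousOn (Continuous.continuousOn (by fun_prop))), ← intervalIntegral.integral_const_mul]
    refine intervalIntegral.integral_congr fun u hu => ?_
    rw [Set.uIcc_of_le zero_le_one] at hu
    have h1 := one_sub_mul_ofReal_mul_ofReal_ne_zero Complex.I_re t u
    have h2 := one_sub_mul_ofReal_mul_ofReal_ne_zero (z := -I) (by simp) t u
    have h6 : 1 - -I * t * u = 1 + I * t * u := by ring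
    rw [h6] at h2
    have h3 : 1 + ((t * u : ℝ) : ℂ) ^ 2 = (1 - I * t * u) * (1 + I * t * u) := by
      push_cast
      linear_combination ((t : ℂ) ^ 2 * u ^ 2) * Complex.I_sq
    have h4 : t - t * u = t * (1 - u) := by ring
    have h5 : (t : ℂ) ^ s ≠ 0 := by simp [Complex.cpow_eq_zero_iff, ht0]
    rw [h6, h3, h4, Complex.ofReal_mul, Complex.ofReal_mul, Complex.mul_cpow_ofReal_nonneg ht hu.1,
      Complex.mul_cpow_ofReal_nonneg ht (by linarith [hu.2]), Complex.cpow_neg (t : ℂ)]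
    push_cast
    generalize I * (t : ℂ) * u = v at h1 h2 ⊢
    field_simp
    ring
  rw [hsplit, hp, hm]
  have hlp := log_one_add_ofReal_mul_I t
  have hlm := log_one_add_ofReal_mul_I (-t)
  have e1 : 1 - I * t = 1 + ((-t : ℝ) : ℂ) * I := by push_cast; ring
  have e2 : 1 - -I * t = 1 + t * I := by ring
  have n1 : 1 + ((-t : ℝ) : ℂ) * I ≠ 0 := e1 ▸ one_sub_mul_ofReal_ne_zero Complex.I_re t
  have n2 : 1 + t * I ≠ 0 := e2 ▸ one_sub_mul_ofReal_ne_zero (z := -I) (by simp) t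
  have n3 : ((1 + t ^ 2 : ℝ) : ℂ) ≠ 0 := by
    exact_mod_cast (by positivity : (1 + t ^ 2 : ℝ) ≠ 0)
  rw [e1, e2, Complex.cpow_def_of_ne_zero n1, Complex.cpow_def_of_ne_zero n2,
    Complex.cpow_def_of_ne_zero n3, hlp, hlm, ← Complex.ofReal_log (by positivity), Complex.sin,
    Real.arctan_neg, neg_sq]
  have x1 : ((Real.log (1 + t ^ 2) : ℝ) / 2 + ((-Real.arctan t : ℝ) : ℂ) * I) * -s =
      (Real.log (1 + t ^ 2) : ℝ) * (-s / 2) + s * Real.arctan t * I := by push_cast; ring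
  have x2 : ((Real.log (1 + t ^ 2) : ℝ) / 2 + (Real.arctan t : ℂ) * I) * -s =
      (Real.log (1 + t ^ 2) : ℝ) * (-s / 2) + -(s * Real.arctan t) * I := by ring
  rw [x1, x2, Complex.exp_add, Complex.exp_add, one_div, mul_inv, Complex.inv_I]
  ring
end
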